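/- arXiv:2504.15572 — 2 statements merged into one kernel-verified Lean document; each statement's English description precedes it below -/
import Mathlib

section
/- (Frequency-localized dispersive estimate with gain) Let f_j = F^{−1}[φ_j F f] be the Littlewood–Paley piece of f at frequency 2^j on ℝ⁵, where φ_j(ξ) = φ(ξ/2^j) is a standard dyadic cutoff. Then for t > 1 and 1 ≤ p ≤ 2, ‖e^{itΔ²} f_j‖_{L^{p/(p−1)}(ℝ⁵)} ≲ 2^{−5(2−p)j/p} t^{−5(2−p)/(2p)} ‖f_j‖_{L^p(ℝ⁵)}. -/
open MeasureTheory ENNReal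
open scoped FourierTransform

noncomputable section

local notation "E" => EuclideanSpace ℝ (Fin 5)

section OscillatoryIntegral

variable {V : Type*} [NormedAddCommGroup V] [InnerProductSpace ℝ V]

/-- The difference quotient `(‖η + r e‖⁴ - ‖η‖⁴) / r` for a unit vector `e`, as a polynomial
in `(e, r, η)`. -/
def quarticDiff (x : V × ℝ × V) : ℝ :=
  (2 * inner ℝ x.2.2 x.1 + x.2.1) *
    (2 * ‖x.2.2‖ ^ 2 + 2 * x.2.1 * inner ℝ x.2.2 x.1 + x.2.1 ^ 2)

/-- The derivative of `quarticDiff` in `η` along the unit vector `e`. -/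
def quarticDiffDeriv (x : V × ℝ × V) : ℝ :=
  2 * (‖x.2.2‖ ^ 2 + ‖x.2.2 + x.2.1 • x.1‖ ^ 2) + 2 * (2 * inner ℝ x.2.2 x.1 + x.2.1) ^ 2

lemma norm_add_smul_pow_four_sub {e : V} (he : ‖e‖ = 1) (r : ℝ) (η : V) :
    ‖η + r • e‖ ^ 4 - ‖η‖ ^ 4 = r * quarticDiff (e, r, η) := by
  have h : ‖η + r • e‖ ^ 2 = ‖η‖ ^ 2 + 2 * r * inner ℝ η e + r ^ 2 := by
    rw [norm_add_sq_real, inner_smul_right, norm_smul, he]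
    simp
    ring
  calc ‖η + r • e‖ ^ 4 - ‖η‖ ^ 4 = (‖η + r • e‖ ^ 2) ^ 2 - ‖η‖ ^ 4 := by ring
    _ = _ := by rw [h, quarticDiff]; ring

lemma contDiff_quarticDiff : ContDiff ℝ (⊤ : ℕ∞) (quarticDiff (V := V)) := by
  have h1 : ContDiff ℝ (⊤ : ℕ∞) fun x : V × ℝ × V ↦ inner ℝ x.2.2 x.1 :=
    contDiff_snd.snd.inner ℝ contDiff_fst
  have h2 : ContDiff ℝ (⊤ : ℕ∞) fun x : V × ℝ × V ↦ ‖x.2.2‖ ^ 2 := contDiff_snd.snd.norm_sq ℝ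
  unfold quarticDiff
  fun_prop

lemma contDiff_quarticDiffDeriv : ContDiff ℝ (⊤ : ℕ∞) (quarticDiffDeriv (V := V)) := by
  have h1 : ContDiff ℝ (⊤ : ℕ∞) fun x : V × ℝ × V ↦ inner ℝ x.2.2 x.1 :=
    contDiff_snd.snd.inner ℝ contDiff_fst
  have h2 : ContDiff ℝ (⊤ : ℕ∞) fun x : V × ℝ × V ↦ ‖x.2.2‖ ^ 2 := contDiff_snd.snd.norm_sq ℝ
  have h3 : ContDiff ℝ (⊤ : ℕ∞) fun x : V × ℝ × V ↦ ‖x.2.2 + x.2.1 • x.1‖ ^ 2 :=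
    ContDiff.norm_sq ℝ (by fun_prop)
  unfold quarticDiffDeriv
  fun_prop

lemma quarticDiffDeriv_pos {x : V × ℝ × V} (hx : x.2.2 ≠ 0) : 0 < quarticDiffDeriv x := by
  have : 0 < ‖x.2.2‖ := norm_pos_iff.2 hx
  unfold quarticDiffDeriv
  positivity

lemma hasLineDerivAt_quarticDiff {e : V} (he : ‖e‖ = 1) (r : ℝ) (η : V) :
    HasLineDerivAt ℝ (fun η ↦ quarticDiff (e, r, η)) (quarticDiffDeriv (e, r, η)) η e := by
  have h : ∀ u : ℝ, quarticDiff (e, r, η + u • e) =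
      (2 * (inner ℝ η e + u) + r) *
        (2 * (‖η‖ ^ 2 + 2 * u * inner ℝ η e + u ^ 2) + 2 * r * (inner ℝ η e + u) + r ^ 2) := by
    intro u
    simp only [quarticDiff]
    rw [norm_add_sq_real, inner_smul_right, norm_smul, inner_add_left, inner_smul_left,
      real_inner_self_eq_norm_sq, he, Real.norm_eq_abs, mul_one, sq_abs]
    simp only [conj_trivial]
    ring
  unfold HasLineDerivAt
  simp only [h]
  have h1 : HasDerivAt (fun u : ℝ ↦ 2 * (inner ℝ η e + u) + r) 2 0 := by
    simpa using (((hasDerivAt_id (0 : ℝ)).const_add (inner ℝ η e)).const_mul 2).add_const r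
  have h2 : HasDerivAt (fun u : ℝ ↦ 2 * (‖η‖ ^ 2 + 2 * u * inner ℝ η e + u ^ 2) +
      2 * r * (inner ℝ η e + u) + r ^ 2) (4 * inner ℝ η e + 2 * r) 0 := by
    have := (((((((hasDerivAt_id (0 : ℝ)).const_mul 2).mul_const (inner ℝ η e)).const_add
      (‖η‖ ^ 2)).add (hasDerivAt_pow 2 (0 : ℝ))).const_mul 2).add
      (((hasDerivAt_id (0 : ℝ)).const_add (inner ℝ η e)).const_mul (2 * r))).add_const (r ^ 2)
    refine this.congr_deriv ?_
    simp
    ring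
  refine (h1.mul h2).congr_deriv ?_
  simp only [quarticDiffDeriv]
  rw [norm_add_sq_real, inner_smul_right, norm_smul, he, Real.norm_eq_abs, mul_one, sq_abs]
  ring

/-- The closed set of `(e, r, η)` with `η` in a fixed annulus. -/
def annulusFiber (V : Type*) [NormedAddCommGroup V] : Set (V × ℝ × V) :=
  {x | 1 / 2 ≤ ‖x.2.2‖ ∧ ‖x.2.2‖ ≤ 3}

omit [InnerProductSpace ℝ V] in
lemma isClosed_annulusFiber : IsClosed (annulusFiber V) :=
  IsClosed.and (isClosed_le (by fun_prop) (by fun_prop)) (isClosed_le (by fun_prop) (by fun_prop))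

/-- The transpose of the operator `(∂ₑΨ)⁻¹ ∂ₑ`, where `Ψ` is `quarticDiff`. -/
def ibpOp (a : V × ℝ × V → ℂ) (x : V × ℝ × V) : ℂ :=
  fderiv ℝ (fun y ↦ a y / (quarticDiffDeriv y : ℂ)) x (0, 0, x.1)

omit [InnerProductSpace ℝ V] in
lemma ne_zero_of_mem_annulusFiber {x : V × ℝ × V} (hx : x ∈ annulusFiber V) : x.2.2 ≠ 0 := by
  rw [← norm_pos_iff]
  have := hx.1
  linarith

lemma contDiff_div_quarticDiffDeriv {a : V × ℝ × V → ℂ} (ha : ContDiff ℝ (⊤ : ℕ∞) a)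
    (hs : tsupport a ⊆ annulusFiber V) :
    ContDiff ℝ (⊤ : ℕ∞) fun y ↦ a y / (quarticDiffDeriv y : ℂ) := by
  have hG : ContDiff ℝ (⊤ : ℕ∞) fun y : V × ℝ × V ↦ (quarticDiffDeriv y : ℂ) :=
    Complex.ofRealCLM.contDiff.comp contDiff_quarticDiffDeriv
  rw [contDiff_iff_contDiffAt]
  intro x
  by_cases hx : x ∈ tsupport a
  · have hne : (quarticDiffDeriv x : ℂ) ≠ 0 := by
      exact_mod_cast (quarticDiffDeriv_pos (ne_zero_of_mem_annulusFiber (hs hx))).ne'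
    simp only [div_eq_mul_inv]
    exact ha.contDiffAt.mul (hG.contDiffAt.inv hne)
  · have : (fun y ↦ a y / (quarticDiffDeriv y : ℂ)) =ᶠ[nhds x] fun _ ↦ 0 := by
      filter_upwards [notMem_tsupport_iff_eventuallyEq.1 hx] with y hy
      simp [hy]
    exact contDiffAt_const.congr_of_eventuallyEq this

lemma tsupport_div_quarticDiffDeriv {a : V × ℝ × V → ℂ} :
    tsupport (fun y ↦ a y / (quarticDiffDeriv y : ℂ)) ⊆ tsupport a :=
  closure_mono fun x hx h ↦ hx (by simp [h])

lemma contDiff_ibpOp {a : V × ℝ × V → ℂ} (ha : ContDiff ℝ (⊤ : ℕ∞) a)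
    (hs : tsupport a ⊆ annulusFiber V) : ContDiff ℝ (⊤ : ℕ∞) (ibpOp a) :=
  ((contDiff_div_quarticDiffDeriv ha hs).fderiv_right (m := (⊤ : ℕ∞)) le_rfl).clm_apply
    (by fun_prop)

lemma tsupport_ibpOp {a : V × ℝ × V → ℂ} : tsupport (ibpOp a) ⊆ tsupport a := by
  refine closure_minimal (fun x hx ↦ ?_) (isClosed_tsupport a)
  have hx' : x ∈ Function.support (fderiv ℝ fun y ↦ a y / (quarticDiffDeriv y : ℂ)) :=
    fun h ↦ hx (by simp [ibpOp, h])
  exact tsupport_div_quarticDiffDeriv (support_fderiv_subset ℝ hx')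

variable [FiniteDimensional ℝ V] [MeasurableSpace V] [BorelSpace V]

omit [MeasurableSpace V] [BorelSpace V] in
lemma hasCompactSupport_fiber {a : V × ℝ × V → ℂ} (hs : tsupport a ⊆ annulusFiber V)
    (e : V) (r : ℝ) : HasCompactSupport fun η ↦ a (e, r, η) := by
  refine HasCompactSupport.intro (isCompact_closedBall (0 : V) 3) fun η hη ↦ ?_
  by_contra h
  exact hη (by simpa using (hs (subset_tsupport a h)).2)

lemma integral_exp_quarticDiff_mul_ibpOp {a : V × ℝ × V → ℂ} (ha : ContDiff ℝ (⊤ : ℕ∞) a)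
    (hs : tsupport a ⊆ annulusFiber V) {e : V} (he : ‖e‖ = 1) (r l : ℝ) :
    ∫ η, Complex.exp (Complex.I * (l * quarticDiff (e, r, η) : ℝ)) * ibpOp a (e, r, η) =
      -(Complex.I * l *
        ∫ η, Complex.exp (Complex.I * (l * quarticDiff (e, r, η) : ℝ)) * a (e, r, η)) := by
  set A : V → ℂ := fun η ↦ Complex.exp (Complex.I * (l * quarticDiff (e, r, η) : ℝ)) with hA
  have hΨ : Continuous fun η ↦ quarticDiff (e, r, η) :=
    contDiff_quarticDiff.continuous.comp (by fun_prop)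
  have hAc : Continuous A := by
    rw [hA]; fun_prop
  have hbC := contDiff_div_quarticDiffDeriv ha hs
  have hc : HasCompactSupport fun η ↦ a (e, r, η) := hasCompactSupport_fiber hs e r
  have hcb : HasCompactSupport fun η ↦ a (e, r, η) / (quarticDiffDeriv (e, r, η) : ℂ) :=
    hasCompactSupport_fiber (a := fun y ↦ a y / (quarticDiffDeriv y : ℂ))
      (tsupport_div_quarticDiffDeriv.trans hs) e r
  have hci : HasCompactSupport fun η ↦ ibpOp a (e, r, η) :=
    hasCompactSupport_fiber (tsupport_ibpOp.trans hs) e r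
  have hcont : ∀ {b : V × ℝ × V → ℂ}, ContDiff ℝ (⊤ : ℕ∞) b →
      Continuous fun η ↦ b (e, r, η) := fun hb ↦ hb.continuous.comp (by fun_prop)
  have hcancel : ∀ η, (quarticDiffDeriv (e, r, η) : ℂ) *
      (a (e, r, η) / (quarticDiffDeriv (e, r, η) : ℂ)) = a (e, r, η) := by
    intro η
    by_cases h : a (e, r, η) = 0
    · simp [h]
    · have := quarticDiffDeriv_pos (ne_zero_of_mem_annulusFiber (hs (subset_tsupport a h)))
      have : (quarticDiffDeriv (e, r, η) : ℂ) ≠ 0 := by exact_mod_cast this.ne'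
      field_simp
  have hAd : ∀ η, HasLineDerivAt ℝ A
      (Complex.I * (l * quarticDiffDeriv (e, r, η)) * A η) η e := by
    intro η
    have h1 := hasLineDerivAt_quarticDiff he r η
    unfold HasLineDerivAt at h1 ⊢
    have h2 := ((h1.const_mul l).ofReal_comp.const_mul Complex.I).cexp
    refine h2.congr_deriv ?_
    simp [hA, mul_comm]
  have key := integral_bilinear_hasLineDerivAt_right_eq_neg_left_of_integrable (μ := volume)
    (f := A) (g := fun η ↦ a (e, r, η) / (quarticDiffDeriv (e, r, η) : ℂ))
    (g' := fun η ↦ ibpOp a (e, r, η)) (B := ContinuousLinearMap.mul ℝ ℂ) (v := e)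
    (f' := fun η ↦ Complex.I * (l * quarticDiffDeriv (e, r, η)) * A η)
    ?_ ?_ ?_ (fun η _ ↦ hAd η) ?_
  · simp only [ContinuousLinearMap.mul_apply'] at key
    rw [key, ← integral_const_mul]
    congr 2
    ext η
    linear_combination (Complex.I * l * A η) * hcancel η
  · simp only [ContinuousLinearMap.mul_apply']
    have : (fun η ↦ Complex.I * (l * quarticDiffDeriv (e, r, η)) * A η *
        (a (e, r, η) / (quarticDiffDeriv (e, r, η) : ℂ))) =
        fun η ↦ Complex.I * l * A η * a (e, r, η) := by
      ext η
      linear_combination (Complex.I * l * A η) * hcancel η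
    rw [this]
    exact Continuous.integrable_of_hasCompactSupport
      ((continuous_const.mul hAc).mul (hcont ha)) hc.mul_left
  · exact Continuous.integrable_of_hasCompactSupport
      (hAc.mul (hcont (contDiff_ibpOp ha hs))) hci.mul_left
  · exact Continuous.integrable_of_hasCompactSupport (hAc.mul (hcont hbC)) hcb.mul_left
  · intro η _
    have h1 := (hbC.differentiable (by simp) (e, r, η)).hasFDerivAt
    have h2 : HasFDerivAt (fun η : V ↦ ((e, r, η) : V × ℝ × V))
        ((0 : V →L[ℝ] V).prod ((0 : V →L[ℝ] ℝ).prod (ContinuousLinearMap.id ℝ V))) η :=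
      (hasFDerivAt_const e η).prodMk ((hasFDerivAt_const r η).prodMk (hasFDerivAt_id η))
    have h3 := (h1.comp η h2).hasLineDerivAt e
    simpa [ibpOp, Function.comp_def] using h3

lemma exists_norm_integral_exp_quarticDiff_le (N : ℕ) :
    ∀ a : V × ℝ × V → ℂ, ContDiff ℝ (⊤ : ℕ∞) a → tsupport a ⊆ annulusFiber V →
      ∃ C : ℝ, ∀ (e : V) (r l : ℝ), ‖e‖ = 1 → |r| ≤ 6 → 0 ≤ l →
        ‖∫ η, Complex.exp (Complex.I * (l * quarticDiff (e, r, η) : ℝ)) * a (e, r, η)‖ * l ^ N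
          ≤ C := by
  induction N with
  | zero =>
    intro a ha hs
    have hK : IsCompact (Metric.closedBall (0 : V) 1 ×ˢ
        (Metric.closedBall (0 : ℝ) 6 ×ˢ Metric.closedBall (0 : V) 3)) :=
      (isCompact_closedBall _ _).prod ((isCompact_closedBall _ _).prod (isCompact_closedBall _ _))
    obtain ⟨M, hM⟩ := hK.exists_bound_of_continuousOn ha.continuous.continuousOn
    refine ⟨M * volume.real (Metric.closedBall (0 : V) 3), fun e r l he hr hl ↦ ?_⟩
    rw [pow_zero, mul_one, ← setIntegral_eq_integral_of_forall_compl_eq_zero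
      (s := Metric.closedBall (0 : V) 3)]
    · refine norm_setIntegral_le_of_norm_le_const measure_closedBall_lt_top fun η hη ↦ ?_
      rw [norm_mul, mul_comm Complex.I, Complex.norm_exp_ofReal_mul_I, one_mul]
      exact hM _ ⟨by simp [he], by simpa using hr, hη⟩
    · intro η hη
      have : a (e, r, η) = 0 := by
        by_contra h
        exact hη (by simpa using (hs (subset_tsupport a h)).2)
      simp [this]
  | succ N ih =>
    intro a ha hs
    obtain ⟨C, hC⟩ := ih (ibpOp a) (contDiff_ibpOp ha hs) (tsupport_ibpOp.trans hs)
    refine ⟨C, fun e r l he hr hl ↦ ?_⟩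
    have := hC e r l he hr hl
    rw [integral_exp_quarticDiff_mul_ibpOp ha hs he, norm_neg, norm_mul, norm_mul,
      Complex.norm_I, Complex.norm_real, Real.norm_of_nonneg hl] at this
    rw [pow_succ]
    linarith

lemma exists_norm_autocorrelation_le [Nontrivial V] {χ : V → ℂ} (hχ : ContDiff ℝ (⊤ : ℕ∞) χ)
    (hs : ∀ ξ, χ ξ ≠ 0 → 1 / 2 ≤ ‖ξ‖ ∧ ‖ξ‖ ≤ 3) (N : ℕ) :
    ∃ C : ℝ, ∀ s : ℝ, 0 < s → ∀ w h : V,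
      ‖∫ η, (Complex.exp (Complex.I * (s * ‖h + η‖ ^ 4 + inner ℝ (h + η) w : ℝ)) * χ (h + η)) *
        (starRingEnd ℂ) (Complex.exp (Complex.I * (s * ‖η‖ ^ 4 + inner ℝ η w : ℝ)) * χ η)‖ ≤
        C * (1 + ‖s • h‖) ^ (-(N : ℝ)) := by
  set a : V × ℝ × V → ℂ := fun x ↦ χ (x.2.2 + x.2.1 • x.1) * (starRingEnd ℂ) (χ x.2.2) with ha
  have haC : ContDiff ℝ (⊤ : ℕ∞) a := by
    have h1 : ContDiff ℝ (⊤ : ℕ∞) fun x : V × ℝ × V ↦ χ (x.2.2 + x.2.1 • x.1) :=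
      hχ.comp (by fun_prop)
    have h2 : ContDiff ℝ (⊤ : ℕ∞) fun x : V × ℝ × V ↦ (starRingEnd ℂ) (χ x.2.2) :=
      Complex.conjCLE.contDiff.comp (hχ.comp (by fun_prop))
    exact h1.mul h2
  have has : tsupport a ⊆ annulusFiber V := by
    refine closure_minimal (fun x hx ↦ ?_) isClosed_annulusFiber
    refine hs _ fun h0 ↦ hx ?_
    simp [ha, h0]
  obtain ⟨C0, hC0⟩ := exists_norm_integral_exp_quarticDiff_le 0 a haC has
  obtain ⟨CN, hCN⟩ := exists_norm_integral_exp_quarticDiff_le N a haC has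
  have hunit : ∀ h : V, ∃ e : V, ‖e‖ = 1 ∧ h = ‖h‖ • e := by
    intro h
    by_cases h0 : h = 0
    · obtain ⟨e, he⟩ := exists_norm_eq V zero_le_one
      exact ⟨e, he, by simp [h0]⟩
    · refine ⟨‖h‖⁻¹ • h, norm_smul_inv_norm (𝕜 := ℝ) h0, ?_⟩
      rw [smul_smul, mul_inv_cancel₀ (norm_ne_zero_iff.2 h0), one_smul]
  obtain ⟨e₀, he₀⟩ := exists_norm_eq V zero_le_one
  have hC0' : 0 ≤ C0 := (by positivity : (0 : ℝ) ≤ _).trans (hC0 e₀ 0 1 he₀ (by simp) zero_le_one)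
  have hCN' : 0 ≤ CN := (by positivity : (0 : ℝ) ≤ _).trans (hCN e₀ 0 1 he₀ (by simp) zero_le_one)
  refine ⟨2 ^ N * (C0 + CN), fun s hs0 w h ↦ ?_⟩
  by_cases h6 : ‖h‖ ≤ 6
  swap
  · have : ∀ η, χ (h + η) * (starRingEnd ℂ) (χ η) = 0 := by
      intro η
      by_contra hne
      have h1 := (hs _ (left_ne_zero_of_mul hne)).2
      have h2 := (hs η fun h ↦ right_ne_zero_of_mul hne (by simp [h])).2
      have := norm_sub_le (h + η) η
      rw [add_sub_cancel_right] at this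
      linarith
    have h0 : ∀ η, (Complex.exp (Complex.I * (s * ‖h + η‖ ^ 4 + inner ℝ (h + η) w : ℝ)) *
        χ (h + η)) * (starRingEnd ℂ) (Complex.exp
          (Complex.I * (s * ‖η‖ ^ 4 + inner ℝ η w : ℝ)) * χ η) = 0 := by
      intro η
      rw [map_mul, mul_mul_mul_comm, this η, mul_zero]
    simp only [h0, integral_zero, norm_zero]
    positivity
  obtain ⟨e, he, hhe⟩ := hunit h
  have hkey : ∀ η, (Complex.exp (Complex.I * (s * ‖h + η‖ ^ 4 + inner ℝ (h + η) w : ℝ)) *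
        χ (h + η)) * (starRingEnd ℂ) (Complex.exp
          (Complex.I * (s * ‖η‖ ^ 4 + inner ℝ η w : ℝ)) * χ η) =
      Complex.exp (Complex.I * (inner ℝ h w : ℝ)) *
        (Complex.exp (Complex.I * ((s * ‖h‖) * quarticDiff (e, ‖h‖, η) : ℝ)) *
          a (e, ‖h‖, η)) := by
    intro η
    have h1 := norm_add_smul_pow_four_sub he ‖h‖ η
    rw [← hhe] at h1
    simp only [ha]
    have h2 : s * ‖h + η‖ ^ 4 + inner ℝ (h + η) w + -(s * ‖η‖ ^ 4 + inner ℝ η w) =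
        inner ℝ h w + s * ‖h‖ * quarticDiff (e, ‖h‖, η) := by
      rw [inner_add_left, mul_assoc s, ← h1, add_comm η h]
      ring
    rw [← hhe, map_mul, ← Complex.exp_conj, mul_mul_mul_comm, ← Complex.exp_add, ← mul_assoc (Complex.exp _) (Complex.exp _),
      ← Complex.exp_add, add_comm η h, map_mul, Complex.conj_I, Complex.conj_ofReal,
      neg_mul, ← mul_neg, ← mul_add, ← mul_add, ← Complex.ofReal_neg, ← Complex.ofReal_add, h2,
      Complex.ofReal_add]
  simp only [hkey]
  rw [integral_const_mul, norm_mul, mul_comm Complex.I, Complex.norm_exp_ofReal_mul_I, one_mul]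
  have hr : |‖h‖| ≤ 6 := by simpa using h6
  have b0 := hC0 e ‖h‖ (s * ‖h‖) he hr (by positivity)
  have bN := hCN e ‖h‖ (s * ‖h‖) he hr (by positivity)
  set J := ‖∫ η, Complex.exp (Complex.I * ((s * ‖h‖) * quarticDiff (e, ‖h‖, η) : ℝ)) *
    a (e, ‖h‖, η)‖ with hJ
  have hJ0 : 0 ≤ J := norm_nonneg _
  rw [norm_smul, Real.norm_of_nonneg hs0.le]
  have hx : 0 ≤ s * ‖h‖ := by positivity
  rw [Real.rpow_neg (by positivity), Real.rpow_natCast, ← div_eq_mul_inv,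
    le_div_iff₀ (by positivity)]
  calc J * (1 + s * ‖h‖) ^ N ≤ J * (2 ^ (N - 1) * (1 ^ N + (s * ‖h‖) ^ N)) := by
        gcongr
        exact add_pow_le zero_le_one hx N
    _ ≤ J * (2 ^ N * (1 ^ N + (s * ‖h‖) ^ N)) := by
        gcongr
        · norm_num
        · omega
    _ = 2 ^ N * (J * (s * ‖h‖) ^ 0 + J * (s * ‖h‖) ^ N) := by simp; ring
    _ ≤ _ := by gcongr

/-- Stationary phase bound for the quartic phase, uniformly in linear perturbations. -/
theorem exists_norm_integral_exp_quartic_le [Nontrivial V] {χ : V → ℂ}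
    (hχ : ContDiff ℝ (⊤ : ℕ∞) χ) (hs : ∀ ξ, χ ξ ≠ 0 → 1 / 2 ≤ ‖ξ‖ ∧ ‖ξ‖ ≤ 3) :
    ∃ C : ℝ, ∀ s : ℝ, 0 < s → ∀ w : V,
      ‖∫ ξ, Complex.exp (Complex.I * (s * ‖ξ‖ ^ 4 + inner ℝ ξ w : ℝ)) * χ ξ‖ ^ 2 ≤
        C * (s ^ Module.finrank ℝ V)⁻¹ := by
  obtain ⟨C, hC⟩ := exists_norm_autocorrelation_le hχ hs (Module.finrank ℝ V + 1)
  refine ⟨C * ∫ h : V, (1 + ‖h‖) ^ (-((Module.finrank ℝ V + 1 : ℕ) : ℝ)), fun s hs0 w ↦ ?_⟩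
  set F : V → ℂ := fun ξ ↦ Complex.exp (Complex.I * (s * ‖ξ‖ ^ 4 + inner ℝ ξ w : ℝ)) * χ ξ with hF
  have hFc : Continuous F := by
    have := hχ.continuous
    rw [hF]; fun_prop
  have hF0 : ∀ ξ, F ξ ≠ 0 → ‖ξ‖ ≤ 3 := fun ξ h ↦ (hs ξ (right_ne_zero_of_mul h)).2
  have hint : Integrable (fun p : V × V ↦ F (p.2 + p.1) * (starRingEnd ℂ) (F p.1))
      (volume.prod volume) := by
    refine Continuous.integrable_of_hasCompactSupport ?_ ?_
    · exact (hFc.comp (by fun_prop)).mul (Complex.continuous_conj.comp (hFc.comp (by fun_prop)))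
    · refine HasCompactSupport.intro ((isCompact_closedBall (0 : V) 3).prod
        (isCompact_closedBall (0 : V) 6)) fun p hp ↦ ?_
      by_contra hne
      have h1 := hF0 _ (left_ne_zero_of_mul hne)
      have h2 := hF0 p.1 fun h ↦ right_ne_zero_of_mul hne (by simp [h])
      have := norm_sub_le (p.2 + p.1) p.1
      rw [add_sub_cancel_right] at this
      exact hp ⟨by simpa using h2, by simpa using (by linarith : ‖p.2‖ ≤ 6)⟩
  have hint1 : Integrable fun h : V ↦ (1 + ‖h‖) ^ (-((Module.finrank ℝ V + 1 : ℕ) : ℝ)) :=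
    integrable_one_add_norm (by push_cast; linarith)
  calc ‖∫ ξ, F ξ‖ ^ 2 = ‖(∫ ξ, F ξ) * (starRingEnd ℂ) (∫ ξ, F ξ)‖ := by
        rw [norm_mul, RCLike.norm_conj, sq]
    _ = ‖∫ η, ∫ h, F (h + η) * (starRingEnd ℂ) (F η)‖ := by
        rw [← integral_conj, ← integral_const_mul]
        congr 2
        ext η
        rw [integral_mul_const, integral_add_right_eq_self]
    _ = ‖∫ h, ∫ η, F (h + η) * (starRingEnd ℂ) (F η)‖ := by
        rw [integral_integral_swap hint]
    _ ≤ ∫ h, C * (1 + ‖s • h‖) ^ (-((Module.finrank ℝ V + 1 : ℕ) : ℝ)) := by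
        refine norm_integral_le_of_norm_le ?_ (Filter.Eventually.of_forall fun h ↦ hC s hs0 w h)
        exact (hint1.comp_smul hs0.ne').const_mul C
    _ = _ := by
        rw [integral_const_mul, Measure.integral_comp_smul_of_nonneg volume
          (fun h : V ↦ (1 + ‖h‖) ^ (-((Module.finrank ℝ V + 1 : ℕ) : ℝ))) s (hR := hs0.le),
          smul_eq_mul]
        ring

end OscillatoryIntegral

section Interpolation

/-- The analytic family `a ↦ (a / |a|) |a| ^ (p (1 + z) / 2)` of the Riesz–Thorin argument. -/
def interpPow (p : ℝ) (a z : ℂ) : ℂ :=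
  a / ‖a‖ * Complex.exp (p * (1 + z) / 2 * Real.log ‖a‖)

lemma norm_interpPow {p : ℝ} (hp : 0 < p) (a : ℂ) {z : ℂ} (hz : 0 ≤ z.re) :
    ‖interpPow p a z‖ = ‖a‖ ^ (p * (1 + z.re) / 2) := by
  by_cases ha : a = 0
  · have : p * (1 + z.re) / 2 ≠ 0 := by positivity
    simp [interpPow, ha, Real.zero_rpow this]
  · have ha' : 0 < ‖a‖ := norm_pos_iff.2 ha
    rw [interpPow, norm_mul, norm_div, Complex.norm_real, norm_norm, div_self ha'.ne', one_mul,
      Complex.norm_exp, Real.rpow_def_of_pos ha']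
    congr 1
    rw [Complex.re_mul_ofReal, mul_comm]
    congr 1
    rw [show (p : ℂ) * (1 + z) / 2 = ((p / 2 : ℝ) : ℂ) * (1 + z) by push_cast; ring,
      Complex.re_ofReal_mul]
    simp
    ring

lemma interpPow_self {p : ℝ} (hp : 0 < p) (a : ℂ) : interpPow p a ((2 / p - 1 : ℝ) : ℂ) = a := by
  by_cases ha : a = 0
  · simp [interpPow, ha]
  · have ha' : 0 < ‖a‖ := norm_pos_iff.2 ha
    have hp' : (p : ℂ) ≠ 0 := by exact_mod_cast hp.ne'
    have h1 : (p : ℂ) * (1 + ((2 / p - 1 : ℝ) : ℂ)) / 2 = 1 := by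
      push_cast
      field_simp
      ring
    have h2 : (‖a‖ : ℂ) ≠ 0 := by exact_mod_cast ha'.ne'
    rw [interpPow, h1, one_mul, ← Complex.ofReal_exp, Real.exp_log ha', div_mul_cancel₀ _ h2]

/-- A weighted finite-dimensional Riesz–Thorin theorem for bilinear forms, between the exponents
`1` and `2`. -/
theorem norm_bilin_sum_le_of_one_of_two {ι κ : Type*} (s : Finset ι) (t : Finset κ) {μ : ι → ℝ}
    {ν : κ → ℝ} (hμ : ∀ i ∈ s, 0 ≤ μ i) (hν : ∀ j ∈ t, 0 ≤ ν j) (M : ι → κ → ℂ) {A : ℝ}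
    (hA : 0 ≤ A)
    (h1 : ∀ (c : ι → ℂ) (d : κ → ℂ), ‖∑ i ∈ s, ∑ j ∈ t, c i * d j * M i j‖ ≤
      A * ((∑ i ∈ s, ‖c i‖ * μ i) * ∑ j ∈ t, ‖d j‖ * ν j))
    (h2 : ∀ (c : ι → ℂ) (d : κ → ℂ), ‖∑ i ∈ s, ∑ j ∈ t, c i * d j * M i j‖ ≤
      (∑ i ∈ s, ‖c i‖ ^ (2 : ℝ) * μ i) ^ (1 / 2 : ℝ) *
        (∑ j ∈ t, ‖d j‖ ^ (2 : ℝ) * ν j) ^ (1 / 2 : ℝ))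
    {p : ℝ} (hp1 : 1 ≤ p) (hp2 : p ≤ 2) (a : ι → ℂ) (b : κ → ℂ) :
    ‖∑ i ∈ s, ∑ j ∈ t, a i * b j * M i j‖ ≤
      A ^ (2 / p - 1) * ((∑ i ∈ s, ‖a i‖ ^ p * μ i) ^ (1 / p) *
        (∑ j ∈ t, ‖b j‖ ^ p * ν j) ^ (1 / p)) := by
  have hp0 : 0 < p := by linarith
  set F : ℂ → ℂ := fun z ↦ ∑ i ∈ s, ∑ j ∈ t, interpPow p (a i) z * interpPow p (b j) z * M i j
    with hF
  set X := ∑ i ∈ s, ‖a i‖ ^ p * μ i with hX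
  set Y := ∑ j ∈ t, ‖b j‖ ^ p * ν j with hY
  have hX0 : 0 ≤ X := Finset.sum_nonneg fun i hi ↦ mul_nonneg (by positivity) (hμ i hi)
  have hY0 : 0 ≤ Y := Finset.sum_nonneg fun i hi ↦ mul_nonneg (by positivity) (hν i hi)
  have hFd : Differentiable ℂ F := by
    simp only [hF, interpPow]
    fun_prop
  set θ : ℝ := 2 / p - 1 with hθ
  have hθ0 : 0 ≤ θ := by
    rw [hθ, sub_nonneg, le_div_iff₀ hp0]; linarith
  have hθ1 : θ ≤ 1 := by
    rw [hθ, sub_le_iff_le_add, div_le_iff₀ hp0]; linarith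
  have hpow : ∀ c z : ℂ, 0 ≤ z.re → z.re ≤ 1 → ‖interpPow p c z‖ ≤ (1 + ‖c‖) ^ p := by
    intro c z hz0 hz1
    rw [norm_interpPow hp0 c hz0]
    calc ‖c‖ ^ (p * (1 + z.re) / 2) ≤ (1 + ‖c‖) ^ (p * (1 + z.re) / 2) := by
          gcongr; linarith
      _ ≤ (1 + ‖c‖) ^ p := by
          apply Real.rpow_le_rpow_of_exponent_le
          · linarith [norm_nonneg c]
          · nlinarith
  have hbdd : BddAbove ((norm ∘ F) '' Complex.HadamardThreeLines.verticalClosedStrip 0 1) := by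
    refine ⟨∑ i ∈ s, ∑ j ∈ t, (1 + ‖a i‖) ^ p * (1 + ‖b j‖) ^ p * ‖M i j‖, ?_⟩
    rintro _ ⟨z, hz, rfl⟩
    obtain ⟨hz0, hz1⟩ : 0 ≤ z.re ∧ z.re ≤ 1 := hz
    refine (norm_sum_le _ _).trans (Finset.sum_le_sum fun i _ ↦
      (norm_sum_le _ _).trans (Finset.sum_le_sum fun j _ ↦ ?_))
    rw [norm_mul, norm_mul]
    gcongr
    · exact hpow _ z hz0 hz1
    · exact hpow _ z hz0 hz1
  have hzero : ∀ z ∈ Complex.re ⁻¹' {0}, ‖F z‖ ≤ X ^ (1 / 2 : ℝ) * Y ^ (1 / 2 : ℝ) := by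
    intro z hz
    have hz : z.re = 0 := hz
    have hn : ∀ c, ‖interpPow p c z‖ ^ (2 : ℝ) = ‖c‖ ^ p := by
      intro c
      rw [norm_interpPow hp0 c hz.ge, ← Real.rpow_mul (norm_nonneg c), hz]
      congr 1; ring
    simpa only [hn] using h2 (fun i ↦ interpPow p (a i) z) fun j ↦ interpPow p (b j) z
  have hone : ∀ z ∈ Complex.re ⁻¹' {1}, ‖F z‖ ≤ A * (X * Y) := by
    intro z hz
    have hz : z.re = 1 := hz
    have hn : ∀ c, ‖interpPow p c z‖ = ‖c‖ ^ p := by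
      intro c
      rw [norm_interpPow hp0 c (by rw [hz]; norm_num), hz]
      congr 1; ring
    simpa only [hn] using h1 (fun i ↦ interpPow p (a i) z) fun j ↦ interpPow p (b j) z
  have key := Complex.HadamardThreeLines.norm_le_interp_of_mem_verticalClosedStrip₀₁' F
    (z := (θ : ℂ)) ⟨by simpa using hθ0, by simpa using hθ1⟩ hFd.diffContOnCl hbdd hzero hone
  simp only [hF, hθ, interpPow_self hp0, Complex.ofReal_re] at key
  refine key.trans (le_of_eq ?_)
  rw [← Real.mul_rpow hX0 hY0, ← Real.mul_rpow hX0 hY0, Real.mul_rpow hA (by positivity),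
    ← Real.rpow_mul (by positivity), mul_left_comm]
  congr 1
  rw [← Real.rpow_add_of_nonneg (by positivity)]
  · congr 1
    field_simp
    ring
  · have : 0 ≤ 1 - θ := by linarith
    positivity
  · exact hθ0

variable {α : Type*} [MeasurableSpace α] {μ : Measure α}

open Classical in
/-- The nonzero values of a simple function. -/
def nonzeroRange (f : SimpleFunc α ℂ) : Finset ℂ := f.range.erase 0

/-- The simple function with the level sets of `f` and the values `c`. -/
def levelComb (f : SimpleFunc α ℂ) (c : ℂ → ℂ) : α → ℂ :=
  fun y ↦ ∑ a ∈ nonzeroRange f, c a * (f ⁻¹' {a}).indicator (fun _ ↦ (1 : ℂ)) y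

lemma levelComb_apply_of_ne (f : SimpleFunc α ℂ) (c : ℂ → ℂ) {y : α} (hy : f y ≠ 0) :
    levelComb f c y = c (f y) := by
  classical
  rw [levelComb, Finset.sum_eq_single (f y)]
  · simp
  · intro b _ hb
    simp [hb.symm]
  · intro h
    exact absurd (Finset.mem_erase.2 ⟨hy, f.mem_range_self y⟩) h

lemma levelComb_apply_of_eq_zero (f : SimpleFunc α ℂ) (c : ℂ → ℂ) {y : α} (hy : f y = 0) :
    levelComb f c y = 0 := by
  classical
  refine Finset.sum_eq_zero fun a ha ↦ ?_
  have : a ≠ 0 := (Finset.mem_erase.1 ha).1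
  simp [hy, this.symm]

lemma levelComb_id (f : SimpleFunc α ℂ) : levelComb f (fun a ↦ a) = f := by
  ext y
  by_cases hy : f y = 0
  · rw [levelComb_apply_of_eq_zero f _ hy, hy]
  · rw [levelComb_apply_of_ne f _ hy]

lemma measure_preimage_lt_top_of_mem_nonzeroRange {f : SimpleFunc α ℂ} (hf : Integrable f μ) {a : ℂ}
    (ha : a ∈ nonzeroRange f) : μ (f ⁻¹' {a}) < ∞ := by
  classical
  exact SimpleFunc.measure_preimage_lt_top_of_integrable f hf (Finset.mem_erase.1 ha).1

lemma memLp_levelSet {f : SimpleFunc α ℂ} (hf : Integrable f μ) {a : ℂ}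
    (ha : a ∈ nonzeroRange f) (r : ℝ≥0∞) :
    MemLp ((f ⁻¹' {a}).indicator fun _ ↦ (1 : ℂ)) r μ :=
  memLp_indicator_const r (f.measurableSet_fiber a) 1
    (Or.inr (measure_preimage_lt_top_of_mem_nonzeroRange hf ha).ne)

lemma memLp_levelComb {f : SimpleFunc α ℂ} (hf : Integrable f μ) (c : ℂ → ℂ) (r : ℝ≥0∞) :
    MemLp (levelComb f c) r μ :=
  memLp_finsetSum _ fun a ha ↦ (memLp_levelSet hf ha r).const_mul (c a)

lemma integral_norm_levelComb_rpow {f : SimpleFunc α ℂ} (hf : Integrable f μ) (c : ℂ → ℂ)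
    {r : ℝ} (hr : r ≠ 0) :
    ∫ y, ‖levelComb f c y‖ ^ r ∂μ = ∑ a ∈ nonzeroRange f, ‖c a‖ ^ r * μ.real (f ⁻¹' {a}) := by
  classical
  have h : ∀ y, ‖levelComb f c y‖ ^ r =
      ∑ a ∈ nonzeroRange f, ‖c a‖ ^ r * (f ⁻¹' {a}).indicator (fun _ ↦ (1 : ℝ)) y := by
    intro y
    by_cases hy : f y = 0
    · rw [levelComb_apply_of_eq_zero f _ hy, norm_zero, Real.zero_rpow hr]
      refine (Finset.sum_eq_zero fun a ha ↦ ?_).symm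
      have : a ≠ 0 := (Finset.mem_erase.1 ha).1
      simp [hy, this.symm]
    · rw [levelComb_apply_of_ne f _ hy, Finset.sum_eq_single (f y)]
      · simp
      · intro b _ hb
        simp [hb.symm]
      · intro h
        exact absurd (Finset.mem_erase.2 ⟨hy, f.mem_range_self y⟩) h
  simp only [h]
  rw [integral_finsetSum]
  · refine Finset.sum_congr rfl fun a ha ↦ ?_
    rw [integral_const_mul, integral_indicator_const _ (f.measurableSet_fiber a)]
    simp
  · intro a ha
    exact ((integrable_indicator_iff (f.measurableSet_fiber a)).2
      (integrableOn_const (measure_preimage_lt_top_of_mem_nonzeroRange hf ha).ne)).const_mul _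

/-- Riesz–Thorin between `L¹ → L^∞` and `L² → L²`, in bilinear form on simple functions. -/
theorem norm_integral_mul_simpleFunc_le {T : (α → ℂ) → α → ℂ} {A : ℝ} (hA : 0 ≤ A)
    (hadd : ∀ f g, Integrable f μ → Integrable g μ → T (f + g) = T f + T g)
    (hsmul : ∀ (c : ℂ) f, T (c • f) = c • T f)
    (h1 : ∀ f, Integrable f μ → ∀ x, ‖T f x‖ ≤ A * ∫ y, ‖f y‖ ∂μ)
    (h2 : ∀ f, Integrable f μ → MemLp f 2 μ →
      MemLp (T f) 2 μ ∧ ∫ x, ‖T f x‖ ^ (2 : ℝ) ∂μ ≤ ∫ x, ‖f x‖ ^ (2 : ℝ) ∂μ)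
    {p : ℝ} (hp1 : 1 ≤ p) (hp2 : p ≤ 2) {f g : SimpleFunc α ℂ} (hf : Integrable f μ)
    (hg : Integrable g μ) :
    ‖∫ x, T f x * g x ∂μ‖ ≤ A ^ (2 / p - 1) *
      ((∫ x, ‖f x‖ ^ p ∂μ) ^ (1 / p) * (∫ x, ‖g x‖ ^ p ∂μ) ^ (1 / p)) := by
  have hlin : ∀ (s : Finset ℂ) (c : ℂ → ℂ) (u : ℂ → α → ℂ), (∀ a ∈ s, Integrable (u a) μ) →
      T (fun y ↦ ∑ a ∈ s, c a * u a y) = fun x ↦ ∑ a ∈ s, c a * T (u a) x := by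
    classical
    intro s c u
    induction s using Finset.induction_on with
    | empty =>
      intro _
      have h0 := hsmul 0 0
      rw [zero_smul, zero_smul] at h0
      simp only [Finset.sum_empty]
      exact h0
    | insert a s ha ih =>
      intro hu
      have hs : ∀ a ∈ s, Integrable (u a) μ := fun b hb ↦ hu b (Finset.mem_insert_of_mem hb)
      have h : (fun y ↦ ∑ b ∈ insert a s, c b * u b y) =
          (c a • u a) + fun y ↦ ∑ b ∈ s, c b * u b y := by
        ext y
        simp [Finset.sum_insert ha]
      rw [h, hadd _ _ ((hu a (Finset.mem_insert_self a s)).smul (c a))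
        (integrable_finsetSum _ fun b hb ↦ (hs b hb).const_mul (c b)), hsmul, ih hs]
      ext x
      simp [Finset.sum_insert ha]
  set M : ℂ → ℂ → ℂ := fun a b ↦ ∫ x, T ((f ⁻¹' {a}).indicator fun _ ↦ 1) x *
    (g ⁻¹' {b}).indicator (fun _ ↦ 1) x ∂μ with hM
  have hcomb : ∀ c d : ℂ → ℂ, ∫ x, T (levelComb f c) x * levelComb g d x ∂μ =
      ∑ a ∈ nonzeroRange f, ∑ b ∈ nonzeroRange g, c a * d b * M a b := by
    intro c d
    have hT : T (levelComb f c) = fun x ↦ ∑ a ∈ nonzeroRange f,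
        c a * T ((f ⁻¹' {a}).indicator fun _ ↦ 1) x :=
      hlin _ c (fun a ↦ (f ⁻¹' {a}).indicator fun _ ↦ 1) fun a ha ↦
        memLp_one_iff_integrable.1 (memLp_levelSet hf ha 1)
    have hint : ∀ a ∈ nonzeroRange f, ∀ b ∈ nonzeroRange g,
        Integrable (fun x ↦ c a * d b * (T ((f ⁻¹' {a}).indicator fun _ ↦ 1) x *
          (g ⁻¹' {b}).indicator (fun _ ↦ 1) x)) μ := fun a ha b hb ↦
      (((h2 _ (memLp_one_iff_integrable.1 (memLp_levelSet hf ha 1))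
        (memLp_levelSet hf ha 2)).1).integrable_mul (memLp_levelSet hg hb 2)).const_mul _
    have hx : ∀ x, T (levelComb f c) x * levelComb g d x =
        ∑ a ∈ nonzeroRange f, ∑ b ∈ nonzeroRange g,
          c a * d b * (T ((f ⁻¹' {a}).indicator fun _ ↦ 1) x *
            (g ⁻¹' {b}).indicator (fun _ ↦ 1) x) := by
      intro x
      rw [hT, levelComb, Finset.sum_mul_sum]
      refine Finset.sum_congr rfl fun a _ ↦ Finset.sum_congr rfl fun b _ ↦ ?_
      ring
    simp only [hx]
    rw [integral_finsetSum _ fun a ha ↦ integrable_finsetSum _ (hint a ha)]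
    refine Finset.sum_congr rfl fun a ha ↦ ?_
    rw [integral_finsetSum _ (hint a ha)]
    refine Finset.sum_congr rfl fun b _ ↦ ?_
    rw [integral_const_mul]
  have hb1 : ∀ c d : ℂ → ℂ,
      ‖∑ a ∈ nonzeroRange f, ∑ b ∈ nonzeroRange g, c a * d b * M a b‖ ≤
        A * ((∑ a ∈ nonzeroRange f, ‖c a‖ * μ.real (f ⁻¹' {a})) *
          ∑ b ∈ nonzeroRange g, ‖d b‖ * μ.real (g ⁻¹' {b})) := by
    intro c d
    have e1 := integral_norm_levelComb_rpow hf c one_ne_zero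
    have e2 := integral_norm_levelComb_rpow hg d one_ne_zero
    simp only [Real.rpow_one] at e1 e2
    rw [← hcomb, ← e1, ← e2, ← mul_assoc, ← integral_const_mul]
    refine norm_integral_le_of_norm_le
      ((memLp_one_iff_integrable.1 (memLp_levelComb hg d 1)).norm.const_mul _)
      (Filter.Eventually.of_forall fun x ↦ ?_)
    rw [norm_mul]
    gcongr
    exact h1 _ (memLp_one_iff_integrable.1 (memLp_levelComb hf c 1)) x
  have hb2 : ∀ c d : ℂ → ℂ,
      ‖∑ a ∈ nonzeroRange f, ∑ b ∈ nonzeroRange g, c a * d b * M a b‖ ≤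
        (∑ a ∈ nonzeroRange f, ‖c a‖ ^ (2 : ℝ) * μ.real (f ⁻¹' {a})) ^ (1 / 2 : ℝ) *
          (∑ b ∈ nonzeroRange g, ‖d b‖ ^ (2 : ℝ) * μ.real (g ⁻¹' {b})) ^ (1 / 2 : ℝ) := by
    intro c d
    obtain ⟨m1, m2⟩ := h2 _ (memLp_one_iff_integrable.1 (memLp_levelComb hf c 1))
      (memLp_levelComb hf c 2)
    rw [← hcomb, ← integral_norm_levelComb_rpow hf c two_ne_zero,
      ← integral_norm_levelComb_rpow hg d two_ne_zero]
    calc ‖∫ x, T (levelComb f c) x * levelComb g d x ∂μ‖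
        ≤ ∫ x, ‖T (levelComb f c) x‖ * ‖levelComb g d x‖ ∂μ := by
          simpa only [norm_mul] using norm_integral_le_integral_norm
            (fun x ↦ T (levelComb f c) x * levelComb g d x)
      _ ≤ (∫ x, ‖T (levelComb f c) x‖ ^ (2 : ℝ) ∂μ) ^ (1 / 2 : ℝ) *
          (∫ x, ‖levelComb g d x‖ ^ (2 : ℝ) ∂μ) ^ (1 / 2 : ℝ) :=
          integral_mul_norm_le_Lp_mul_Lq Real.HolderConjugate.two_two (by simpa using m1)
            (by simpa using memLp_levelComb hg d 2)
      _ ≤ _ := by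
          gcongr
  have key := norm_bilin_sum_le_of_one_of_two (nonzeroRange f) (nonzeroRange g)
    (μ := fun a ↦ μ.real (f ⁻¹' {a})) (ν := fun b ↦ μ.real (g ⁻¹' {b}))
    (fun _ _ ↦ measureReal_nonneg) (fun _ _ ↦ measureReal_nonneg) M hA hb1 hb2 hp1 hp2
    (fun a ↦ a) (fun b ↦ b)
  have hp0 : p ≠ 0 := by linarith
  rwa [← hcomb, ← integral_norm_levelComb_rpow hf _ hp0, ← integral_norm_levelComb_rpow hg _ hp0,
    levelComb_id, levelComb_id] at key

end Interpolation

section Interpolation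

variable {α : Type*} [MeasurableSpace α] {μ : Measure α}

lemma exists_simpleFunc_approx {f : α → ℂ} (hf : AEStronglyMeasurable f μ) :
    ∃ F : ℕ → SimpleFunc α ℂ, (∀ n, ∀ᵐ x ∂μ, ‖F n x‖ ≤ 2 * ‖f x‖) ∧
      ∀ᵐ x ∂μ, Filter.Tendsto (fun n ↦ F n x) Filter.atTop (nhds (f x)) := by
  have hm : Measurable (hf.mk f) := hf.stronglyMeasurable_mk.measurable
  refine ⟨SimpleFunc.approxOn (hf.mk f) hm Set.univ 0 (Set.mem_univ _), fun n ↦ ?_, ?_⟩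
  · filter_upwards [hf.ae_eq_mk] with x hx
    rw [hx, two_mul]
    exact SimpleFunc.norm_approxOn_zero_le hm (Set.mem_univ _) x n
  · filter_upwards [hf.ae_eq_mk] with x hx
    rw [hx]
    exact SimpleFunc.tendsto_approxOn hm (Set.mem_univ _) (by simp)

lemma MeasureTheory.SimpleFunc.integrable_of_norm_le {f : α → ℂ} {r : ℝ≥0∞} (hr0 : r ≠ 0)
    (hr : r ≠ ∞) (hf : MemLp f r μ) {F : SimpleFunc α ℂ} (hF : ∀ᵐ x ∂μ, ‖F x‖ ≤ 2 * ‖f x‖) :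
    Integrable F μ :=
  (SimpleFunc.memLp_iff_integrable hr0 hr).1
    (hf.of_le_mul F.aestronglyMeasurable hF)

/-- Riesz–Thorin between `L¹ → L^∞` and `L² → L²`, tested against simple functions. -/
lemma norm_integral_mul_simpleFunc_le_of_integrable {T : (α → ℂ) → α → ℂ} {A : ℝ} (hA : 0 ≤ A)
    (hadd : ∀ f g, Integrable f μ → Integrable g μ → T (f + g) = T f + T g)
    (hsmul : ∀ (c : ℂ) f, T (c • f) = c • T f)
    (h1 : ∀ f, Integrable f μ → ∀ x, ‖T f x‖ ≤ A * ∫ y, ‖f y‖ ∂μ)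
    (h2 : ∀ f, Integrable f μ → MemLp f 2 μ →
      MemLp (T f) 2 μ ∧ ∫ x, ‖T f x‖ ^ (2 : ℝ) ∂μ ≤ ∫ x, ‖f x‖ ^ (2 : ℝ) ∂μ)
    {p : ℝ} (hp1 : 1 ≤ p) (hp2 : p ≤ 2) {f : α → ℂ} {g : SimpleFunc α ℂ} (hf : Integrable f μ)
    (hf2 : MemLp f 2 μ) (hfp : Integrable (fun x ↦ ‖f x‖ ^ p) μ) (hg : Integrable g μ) :
    ‖∫ x, T f x * g x ∂μ‖ ≤ 2 * A ^ (2 / p - 1) *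
      ((∫ x, ‖f x‖ ^ p ∂μ) ^ (1 / p) * (∫ x, ‖g x‖ ^ p ∂μ) ^ (1 / p)) := by
  have hp0 : 0 < p := by linarith
  obtain ⟨F, hFb, hFl⟩ := exists_simpleFunc_approx hf.1
  have hFi : ∀ n, Integrable (F n) μ := fun n ↦
    SimpleFunc.integrable_of_norm_le one_ne_zero (by simp) (memLp_one_iff_integrable.2 hf) (hFb n)
  have hF2 : ∀ n, MemLp (F n) 2 μ := fun n ↦ hf2.of_le_mul (F n).aestronglyMeasurable (hFb n)
  have hg2 : MemLp g 2 μ := (SimpleFunc.memLp_iff_integrable two_ne_zero (by simp)).2 hg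
  have hlim : Filter.Tendsto (fun n ↦ ∫ x, ‖(f - ⇑(F n)) x‖ ∂μ) Filter.atTop (nhds 0) := by
    rw [← integral_zero α ℝ (μ := μ)]
    refine tendsto_integral_of_dominated_convergence (fun x ↦ 3 * ‖f x‖)
      (fun n ↦ (hf.1.sub (F n).aestronglyMeasurable).norm) (hf.norm.const_mul 3) (fun n ↦ ?_) ?_
    · filter_upwards [hFb n] with x hx
      rw [norm_norm, Pi.sub_apply]
      linarith [norm_sub_le (f x) (F n x)]
    · filter_upwards [hFl] with x hx
      simpa using (tendsto_const_nhds (x := f x).sub hx).norm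
  have hpow : ∀ n, (∫ x, ‖F n x‖ ^ p ∂μ) ^ (1 / p) ≤ 2 * (∫ x, ‖f x‖ ^ p ∂μ) ^ (1 / p) := by
    intro n
    have h : ∫ x, ‖F n x‖ ^ p ∂μ ≤ 2 ^ p * ∫ x, ‖f x‖ ^ p ∂μ := by
      rw [← integral_const_mul]
      refine integral_mono_of_nonneg (Filter.Eventually.of_forall fun x ↦ by positivity)
        (hfp.const_mul _) ?_
      filter_upwards [hFb n] with x hx
      rw [← Real.mul_rpow (by norm_num) (norm_nonneg _)]
      gcongr
    calc (∫ x, ‖F n x‖ ^ p ∂μ) ^ (1 / p) ≤ (2 ^ p * ∫ x, ‖f x‖ ^ p ∂μ) ^ (1 / p) := by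
          gcongr
      _ = _ := by
          rw [Real.mul_rpow (by positivity) (integral_nonneg fun _ ↦ by positivity),
            ← Real.rpow_mul (by norm_num), mul_one_div_cancel hp0.ne', Real.rpow_one]
  have hle : ∀ n, ‖∫ x, T f x * g x ∂μ‖ ≤ A * (∫ x, ‖(f - ⇑(F n)) x‖ ∂μ) * (∫ x, ‖g x‖ ∂μ) +
      2 * A ^ (2 / p - 1) *
      ((∫ x, ‖f x‖ ^ p ∂μ) ^ (1 / p) * (∫ x, ‖g x‖ ^ p ∂μ) ^ (1 / p)) := by
    intro n
    have hd : Integrable (f - ⇑(F n)) μ := hf.sub (hFi n)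
    have hT : T f = T (f - ⇑(F n)) + T (F n) := by
      rw [← hadd _ _ hd (hFi n), sub_add_cancel]
    have i1 : Integrable (fun x ↦ T (f - ⇑(F n)) x * g x) μ :=
      (h2 _ hd (hf2.sub (hF2 n))).1.integrable_mul hg2
    have i2 : Integrable (fun x ↦ T (F n) x * g x) μ :=
      (h2 _ (hFi n) (hF2 n)).1.integrable_mul hg2
    simp only [hT, Pi.add_apply, add_mul]
    rw [integral_add i1 i2]
    refine (norm_add_le _ _).trans (add_le_add ?_ ?_)
    · rw [← integral_const_mul]
      refine norm_integral_le_of_norm_le (hg.norm.const_mul _)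
        (Filter.Eventually.of_forall fun x ↦ ?_)
      rw [norm_mul]
      gcongr
      exact h1 _ hd x
    · refine (norm_integral_mul_simpleFunc_le hA hadd hsmul h1 h2 hp1 hp2 (hFi n) hg).trans ?_
      have hθ : 0 ≤ A ^ (2 / p - 1) := by positivity
      have hY : 0 ≤ (∫ x, ‖g x‖ ^ p ∂μ) ^ (1 / p) :=
        Real.rpow_nonneg (integral_nonneg fun _ ↦ by positivity) _
      calc A ^ (2 / p - 1) * ((∫ x, ‖F n x‖ ^ p ∂μ) ^ (1 / p) * (∫ x, ‖g x‖ ^ p ∂μ) ^ (1 / p))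
          ≤ A ^ (2 / p - 1) *
            ((2 * (∫ x, ‖f x‖ ^ p ∂μ) ^ (1 / p)) * (∫ x, ‖g x‖ ^ p ∂μ) ^ (1 / p)) := by
            gcongr
            exact hpow n
        _ = _ := by ring
  refine ge_of_tendsto' (x := Filter.atTop) ?_ hle
  simpa using ((hlim.const_mul A).mul_const (∫ x, ‖g x‖ ∂μ)).add_const (2 * A ^ (2 / p - 1) *
      ((∫ x, ‖f x‖ ^ p ∂μ) ^ (1 / p) * (∫ x, ‖g x‖ ^ p ∂μ) ^ (1 / p)))

lemma integral_norm_rpow_le_of_testing {h : α → ℂ} {p q B : ℝ} (hpq : p.HolderConjugate q)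
    (hB : 0 ≤ B) (hm : AEStronglyMeasurable h μ) (hq : Integrable (fun x ↦ ‖h x‖ ^ q) μ)
    (htest : ∀ g : SimpleFunc α ℂ, Integrable g μ →
      ‖∫ x, h x * g x ∂μ‖ ≤ B * (∫ x, ‖g x‖ ^ p ∂μ) ^ (1 / p)) :
    (∫ x, ‖h x‖ ^ q ∂μ) ^ (1 / q) ≤ 2 * B := by
  have hp0 : 0 < p := hpq.pos
  have hq0 : 0 < q := hpq.symm.pos
  set N := ∫ x, ‖h x‖ ^ q ∂μ with hN
  have hN0 : 0 ≤ N := integral_nonneg fun _ ↦ by positivity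
  set G : α → ℂ := fun x ↦ (starRingEnd ℂ (h x)) * ((‖h x‖ ^ (q - 2) : ℝ) : ℂ) with hG
  have hGm : AEStronglyMeasurable G μ :=
    (Complex.continuous_conj.comp_aestronglyMeasurable hm).mul
      (Complex.continuous_ofReal.comp_aestronglyMeasurable
        (hm.norm.aemeasurable.pow_const (q - 2)).aestronglyMeasurable)
  have hGn : ∀ x, ‖G x‖ = ‖h x‖ ^ (q - 1) := by
    intro x
    by_cases hx : h x = 0
    · have : q - 1 ≠ 0 := by linarith [hpq.symm.lt]
      simp [hG, hx, Real.zero_rpow this]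
    · have hx' : 0 < ‖h x‖ := norm_pos_iff.2 hx
      rw [hG]
      simp only [norm_mul, RCLike.norm_conj, Complex.norm_real, Real.norm_eq_abs]
      rw [abs_of_nonneg (by positivity), show q - 1 = 1 + (q - 2) by ring, Real.rpow_add hx',
        Real.rpow_one]
  have hGp : ∀ x, ‖G x‖ ^ p = ‖h x‖ ^ q := by
    intro x
    rw [hGn, ← Real.rpow_mul (norm_nonneg _)]
    congr 1
    have := hpq.mul_eq_add
    linarith
  have hhG : ∀ x, h x * G x = ((‖h x‖ ^ q : ℝ) : ℂ) := by
    intro x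
    by_cases hx : h x = 0
    · simp [hx, Real.zero_rpow hq0.ne']
    · have hx' : 0 < ‖h x‖ := norm_pos_iff.2 hx
      rw [hG]
      simp only
      rw [← mul_assoc, Complex.mul_conj, Complex.normSq_eq_norm_sq, ← Complex.ofReal_mul,
        ← Real.rpow_natCast, ← Real.rpow_add hx']
      congr 2
      push_cast
      ring
  have hGL : MemLp G (ENNReal.ofReal p) μ := by
    rw [← integrable_norm_rpow_iff hGm (by simpa using hp0) (by simp),
      ENNReal.toReal_ofReal hp0.le]
    simpa only [hGp] using hq
  obtain ⟨F, hFb, hFl⟩ := exists_simpleFunc_approx hGm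
  have hFi : ∀ n, Integrable (F n) μ := fun n ↦
    SimpleFunc.integrable_of_norm_le (by simpa using hp0) (by simp) hGL (hFb n)
  have hlim : Filter.Tendsto (fun n ↦ ‖∫ x, h x * F n x ∂μ‖) Filter.atTop (nhds N) := by
    have h0 : ‖∫ x, h x * G x ∂μ‖ = N := by
      simp only [hhG]
      rw [integral_complex_ofReal, Complex.norm_real, Real.norm_of_nonneg hN0]
    rw [← h0]
    refine (tendsto_integral_of_dominated_convergence (fun x ↦ 2 * ‖h x‖ ^ q)
      (fun n ↦ hm.mul (F n).aestronglyMeasurable) (hq.const_mul 2) (fun n ↦ ?_) ?_).norm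
    · filter_upwards [hFb n] with x hx
      have e : ‖h x‖ * ‖G x‖ = ‖h x‖ ^ q := by
        rw [← norm_mul, hhG, Complex.norm_real, Real.norm_of_nonneg (by positivity)]
      rw [Pi.mul_apply, norm_mul, ← e]
      nlinarith [norm_nonneg (h x)]
    · filter_upwards [hFl] with x hx
      exact hx.const_mul _
  have hle : N ≤ 2 * B * N ^ (1 / p) := by
    refine le_of_tendsto' hlim fun n ↦ (htest (F n) (hFi n)).trans ?_
    have h : ∫ x, ‖F n x‖ ^ p ∂μ ≤ 2 ^ p * N := by
      rw [hN, ← integral_const_mul]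
      refine integral_mono_of_nonneg (Filter.Eventually.of_forall fun x ↦ by positivity)
        (hq.const_mul _) ?_
      filter_upwards [hFb n] with x hx
      rw [← hGp, ← Real.mul_rpow (by norm_num) (norm_nonneg _)]
      gcongr
    calc B * (∫ x, ‖F n x‖ ^ p ∂μ) ^ (1 / p) ≤ B * (2 ^ p * N) ^ (1 / p) := by
          gcongr
      _ = _ := by
          rw [Real.mul_rpow (by positivity) hN0,
            ← Real.rpow_mul (by norm_num), mul_one_div_cancel hp0.ne', Real.rpow_one]
          ring
  rcases hN0.eq_or_lt with h0 | h0
  · rw [← h0, Real.zero_rpow (by positivity)]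
    positivity
  · have e : N = N ^ (1 / q) * N ^ (1 / p) := by
      have := hpq.symm.inv_add_inv_eq_one
      rw [← Real.rpow_add h0, one_div, one_div, this, Real.rpow_one]
    have hpos : 0 < N ^ (1 / p) := by positivity
    exact le_of_mul_le_mul_right (e ▸ hle) hpos

/-- Riesz–Thorin between `L¹ → L^∞` and `L² → L²` (up to a factor `4`). -/
theorem eLpNorm_le_of_one_of_two {T : (α → ℂ) → α → ℂ} {A : ℝ} (hA : 0 ≤ A)
    (hadd : ∀ f g, Integrable f μ → Integrable g μ → T (f + g) = T f + T g)
    (hsmul : ∀ (c : ℂ) f, T (c • f) = c • T f)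
    (h1 : ∀ f, Integrable f μ → ∀ x, ‖T f x‖ ≤ A * ∫ y, ‖f y‖ ∂μ)
    (h2 : ∀ f, Integrable f μ → MemLp f 2 μ →
      MemLp (T f) 2 μ ∧ ∫ x, ‖T f x‖ ^ (2 : ℝ) ∂μ ≤ ∫ x, ‖f x‖ ^ (2 : ℝ) ∂μ)
    {p : ℝ} (hp1 : 1 ≤ p) (hp2 : p ≤ 2) {q : ℝ≥0∞} (hpq : 1 / ENNReal.ofReal p + 1 / q = 1)
    {f : α → ℂ} (hf : Integrable f μ) (hf2 : MemLp f 2 μ) :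
    eLpNorm (T f) q μ ≤ ENNReal.ofReal (4 * A ^ (2 / p - 1)) * eLpNorm f (ENNReal.ofReal p) μ := by
  have hp0 : 0 < p := by linarith
  set M := A * ∫ y, ‖f y‖ ∂μ with hM
  have hM0 : 0 ≤ M := mul_nonneg hA (integral_nonneg fun _ ↦ norm_nonneg _)
  rcases hp1.eq_or_lt with rfl | hp1'
  · have hq : q = ∞ := by simpa using hpq
    rw [hq, eLpNorm_exponent_top, ENNReal.ofReal_one, eLpNorm_one_eq_lintegral_enorm,
      ← ofReal_integral_norm_eq_lintegral_enorm hf, ← ENNReal.ofReal_mul (by positivity)]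
    refine (eLpNormEssSup_le_of_ae_bound (Filter.Eventually.of_forall (h1 f hf))).trans ?_
    norm_num
    refine ENNReal.ofReal_le_ofReal ?_
    nlinarith
  · have hc := Real.HolderConjugate.conjExponent hp1'
    set r := p.conjExponent with hr
    have hr0 : 0 < r := hc.symm.pos
    have hr2 : 2 ≤ r := by
      have := hc.mul_eq_add
      nlinarith
    have hqr : q = ENNReal.ofReal r := by
      have h : 1 / ENNReal.ofReal p + 1 / ENNReal.ofReal r = 1 := by
        rw [one_div, one_div, ← ENNReal.ofReal_inv_of_pos hp0, ← ENNReal.ofReal_inv_of_pos hr0,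
          ← ENNReal.ofReal_add (by positivity) (by positivity), hc.inv_add_inv_eq_one,
          ENNReal.ofReal_one]
      have h' := hpq.trans h.symm
      rw [ENNReal.add_right_inj (by simpa using hp0), one_div, one_div] at h'
      exact inv_injective h'
    obtain ⟨hT2, -⟩ := h2 f hf hf2
    have hTr : Integrable (fun x ↦ ‖T f x‖ ^ r) μ := by
      have h := (hT2.integrable_norm_rpow two_ne_zero (by simp)).const_mul (M ^ (r - 2))
      refine h.mono' (hT2.1.norm.aemeasurable.pow_const r).aestronglyMeasurable
        (Filter.Eventually.of_forall fun x ↦ ?_)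
      rw [Real.norm_of_nonneg (by positivity), ENNReal.toReal_ofNat]
      calc ‖T f x‖ ^ r = ‖T f x‖ ^ (r - 2) * ‖T f x‖ ^ (2 : ℝ) := by
            rw [← Real.rpow_add_of_nonneg (norm_nonneg _) (by linarith) (by norm_num),
              sub_add_cancel]
        _ ≤ _ := by
            gcongr
            exact h1 f hf x
    have hfp : Integrable (fun x ↦ ‖f x‖ ^ p) μ := by
      have h := hf.norm.add (hf2.integrable_norm_rpow two_ne_zero (by simp))
      refine h.mono' (hf.1.norm.aemeasurable.pow_const p).aestronglyMeasurable
        (Filter.Eventually.of_forall fun x ↦ ?_)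
      rw [Real.norm_of_nonneg (by positivity), ENNReal.toReal_ofNat, Pi.add_apply]
      rcases le_total ‖f x‖ 1 with hx | hx
      · have := Real.rpow_le_rpow_of_exponent_ge' (norm_nonneg (f x)) hx zero_le_one hp1
        rw [Real.rpow_one] at this
        have : 0 ≤ ‖f x‖ ^ (2 : ℝ) := by positivity
        linarith
      · have := Real.rpow_le_rpow_of_exponent_le hx hp2
        linarith
    have hfL : MemLp f (ENNReal.ofReal p) μ := by
      rw [← integrable_norm_rpow_iff hf.1 (by simpa using hp0) (by simp),
        ENNReal.toReal_ofReal hp0.le]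
      exact hfp
    have hTL : MemLp (T f) (ENNReal.ofReal r) μ := by
      rw [← integrable_norm_rpow_iff hT2.1 (by simpa using hr0) (by simp),
        ENNReal.toReal_ofReal hr0.le]
      exact hTr
    have key := integral_norm_rpow_le_of_testing hc
      (B := 2 * A ^ (2 / p - 1) * (∫ x, ‖f x‖ ^ p ∂μ) ^ (1 / p))
      (mul_nonneg (by positivity) (Real.rpow_nonneg (integral_nonneg fun _ ↦ by positivity) _))
      hT2.1 hTr fun g hg ↦ by
        rw [mul_assoc]
        exact norm_integral_mul_simpleFunc_le_of_integrable hA hadd hsmul h1 h2 hp1 hp2 hf hf2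
          hfp hg
    rw [hqr, hTL.eLpNorm_eq_integral_rpow_norm (by simpa using hr0) (by simp),
      hfL.eLpNorm_eq_integral_rpow_norm (by simpa using hp0) (by simp),
      ← ENNReal.ofReal_mul (by positivity), ENNReal.toReal_ofReal hp0.le,
      ENNReal.toReal_ofReal hr0.le, ← one_div, ← one_div]
    refine ENNReal.ofReal_le_ofReal (key.trans_eq ?_)
    ring

end Interpolation

section Plancherel

variable {V : Type*} [NormedAddCommGroup V] [InnerProductSpace ℝ V] [FiniteDimensional ℝ V]
  [MeasurableSpace V] [BorelSpace V]

lemma continuous_fourier_of_integrable {w : V → ℂ} (hw : Integrable w) : Continuous (𝓕 w) :=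
  VectorFourier.fourierIntegral_continuous Real.continuous_fourierChar continuous_inner hw

/-- On `L¹ ∩ L²` the Fourier integral agrees with the `L²` Fourier transform. -/
lemma fourier_toLp_ae_eq {w : V → ℂ} (hw : Integrable w) (hw2 : MemLp w 2) :
    (𝓕 (hw2.toLp w) : Lp ℂ 2 (volume : Measure V)) =ᵐ[volume] 𝓕 w := by
  have hcont : Continuous (𝓕 w) := continuous_fourier_of_integrable hw
  have hloc : LocallyIntegrable (𝓕 (hw2.toLp w) : Lp ℂ 2 (volume : Measure V)) volume :=
    (Lp.memLp _).locallyIntegrable (by norm_num)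
  refine ae_eq_of_integral_contDiff_smul_eq hloc hcont.locallyIntegrable fun g hg hgc ↦ ?_
  have hgc' : HasCompactSupport (fun x ↦ (g x : ℂ)) := hgc.comp_left (g := ((↑) : ℝ → ℂ)) rfl
  have hg' : ContDiff ℝ (⊤ : ℕ∞) (fun x ↦ (g x : ℂ)) := Complex.ofRealCLM.contDiff.comp hg
  set s : SchwartzMap V ℂ := hgc'.toSchwartzMap hg' with hs
  have e1 := congrArg (fun D ↦ D s) (Lp.fourier_toTemperedDistribution_eq (hw2.toLp w))
  rw [TemperedDistribution.fourier_apply, Lp.toTemperedDistribution_apply,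
    Lp.toTemperedDistribution_apply] at e1
  have e2 := VectorFourier.integral_fourierIntegral_smul_eq_flip (L := innerₗ V) (μ := volume) (ν := volume)
     Real.continuous_fourierChar continuous_inner s.integrable hw
  have e3 : ∫ x, (𝓕 s) x • (hw2.toLp w) x = ∫ x, (𝓕 s) x • w x := 
    integral_congr_ae (by
      filter_upwards [hw2.coeFn_toLp] with x hx
      rw [hx])
  rw [e3] at e1
  rw [flip_innerₗ] at e2
  have e4 : ∀ h : V → ℂ, ∫ x, g x • h x = ∫ x, s x • h x := fun h ↦ rfl
  rw [e4, e4]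
  exact e1.symm.trans e2

/-- Plancherel's theorem on `L¹ ∩ L²`. -/
lemma memLp_fourier_and_eLpNorm_eq {w : V → ℂ} (hw : Integrable w) (hw2 : MemLp w 2) :
    MemLp (𝓕 w) 2 ∧ eLpNorm (𝓕 w) 2 volume = eLpNorm w 2 volume := by
  have h := fourier_toLp_ae_eq hw hw2
  refine ⟨(memLp_congr_ae h).1 (Lp.memLp _), ?_⟩
  rw [← eLpNorm_congr_ae h, ← eLpNorm_congr_ae hw2.coeFn_toLp, ← Lp.enorm_def, ← Lp.enorm_def,
    ← ofReal_norm, ← ofReal_norm, Lp.norm_fourier_eq]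

end Plancherel

section Multiplier

variable {V : Type*} [NormedAddCommGroup V] [InnerProductSpace ℝ V] [FiniteDimensional ℝ V]
  [MeasurableSpace V] [BorelSpace V] {m : V → ℂ}

lemma integrable_fourierInv_of_contDiff (hm : ContDiff ℝ (⊤ : ℕ∞) m) (hc : HasCompactSupport m) :
    Integrable (𝓕⁻ m) := by
  have h := (𝓕⁻ (hc.toSchwartzMap hm)).integrable (μ := volume)
  rwa [SchwartzMap.fourierInv_coe] at h

lemma continuous_fourierInv_of_contDiff (hm : ContDiff ℝ (⊤ : ℕ∞) m) (hc : HasCompactSupport m) :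
    Continuous (𝓕⁻ m) := by
  have h := (𝓕⁻ (hc.toSchwartzMap hm)).continuous
  rwa [SchwartzMap.fourierInv_coe] at h

lemma fourier_fourierInv_of_contDiff (hm : ContDiff ℝ (⊤ : ℕ∞) m) (hc : HasCompactSupport m) :
    𝓕 (𝓕⁻ m) = m := by
  refine hm.continuous.fourier_fourierInv_eq (hm.continuous.integrable_of_hasCompactSupport hc) ?_
  have h := (𝓕 (hc.toSchwartzMap hm)).integrable (μ := volume)
  rwa [SchwartzMap.fourier_coe] at h

lemma norm_fourierInv_le (w : V → ℂ) (x : V) : ‖𝓕⁻ w x‖ ≤ ∫ ξ, ‖w ξ‖ := by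
  rw [Real.fourierInv_eq]
  refine (norm_integral_le_integral_norm _).trans_eq ?_
  simp

/-- The convolution operator with Fourier multiplier `m`. -/
def multiplierOp (m : V → ℂ) (f : V → ℂ) : V → ℂ :=
  convolution (𝓕⁻ m) f (ContinuousLinearMap.mul ℂ ℂ) volume

lemma integrable_multiplierOp (hm : ContDiff ℝ (⊤ : ℕ∞) m) (hc : HasCompactSupport m)
    {f : V → ℂ} (hf : Integrable f) : Integrable (multiplierOp m f) :=
  (integrable_fourierInv_of_contDiff hm hc).integrable_convolution _ hf

lemma continuous_multiplierOp (hm : ContDiff ℝ (⊤ : ℕ∞) m) (hc : HasCompactSupport m)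
    {f : V → ℂ} (hf : Integrable f) : Continuous (multiplierOp m f) := by
  refine BddAbove.continuous_convolution_left_of_integrable _ ⟨∫ ξ, ‖m ξ‖, ?_⟩
    (continuous_fourierInv_of_contDiff hm hc) hf
  rintro _ ⟨x, rfl⟩
  exact norm_fourierInv_le m x

lemma norm_multiplierOp_le {A : ℝ} (hA : ∀ x, ‖𝓕⁻ m x‖ ≤ A) {f : V → ℂ} (hf : Integrable f)
    (x : V) : ‖multiplierOp m f x‖ ≤ A * ∫ y, ‖f y‖ := by
  rw [multiplierOp, convolution_eq_swap, ← integral_const_mul]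
  refine norm_integral_le_of_norm_le (hf.norm.const_mul A)
    (Filter.Eventually.of_forall fun y ↦ ?_)
  rw [ContinuousLinearMap.mul_apply', norm_mul]
  gcongr
  exact hA _

lemma memLp_two_multiplierOp (hm : ContDiff ℝ (⊤ : ℕ∞) m) (hc : HasCompactSupport m)
    {f : V → ℂ} (hf : Integrable f) : MemLp (multiplierOp m f) 2 := by
  have hi := integrable_multiplierOp hm hc hf
  rw [← integrable_norm_rpow_iff hi.1 two_ne_zero (by simp), ENNReal.toReal_ofNat]
  refine (hi.norm.const_mul ((∫ ξ, ‖m ξ‖) * ∫ y, ‖f y‖)).mono'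
    (hi.1.norm.aemeasurable.pow_const 2).aestronglyMeasurable
    (Filter.Eventually.of_forall fun x ↦ ?_)
  rw [Real.norm_of_nonneg (by positivity), Real.rpow_two, sq]
  gcongr
  exact norm_multiplierOp_le (norm_fourierInv_le m) hf x

lemma fourier_multiplierOp (hm : ContDiff ℝ (⊤ : ℕ∞) m) (hc : HasCompactSupport m)
    {f : V → ℂ} (hf : Integrable f) : 𝓕 (multiplierOp m f) = fun ξ ↦ m ξ * 𝓕 f ξ := by
  ext ξ
  have h := Real.fourier_mul_convolution_eq (integrable_fourierInv_of_contDiff hm hc) hf ξ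
  rwa [fourier_fourierInv_of_contDiff hm hc] at h

lemma fourierInv_mul_fourier (hm : ContDiff ℝ (⊤ : ℕ∞) m) (hc : HasCompactSupport m)
    {f : V → ℂ} (hf : Integrable f) : (𝓕⁻ fun ξ ↦ m ξ * 𝓕 f ξ) = multiplierOp m f := by
  rw [← fourier_multiplierOp hm hc hf]
  refine (continuous_multiplierOp hm hc hf).fourierInv_fourier_eq
    (integrable_multiplierOp hm hc hf) ?_
  rw [fourier_multiplierOp hm hc hf]
  exact (hm.continuous.mul (continuous_fourier_of_integrable hf)).integrable_of_hasCompactSupport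
    hc.mul_right

lemma convolutionExists_fourierInv (hm : ContDiff ℝ (⊤ : ℕ∞) m) (hc : HasCompactSupport m)
    {f : V → ℂ} (hf : Integrable f) :
    ConvolutionExists (𝓕⁻ m) f (ContinuousLinearMap.mul ℂ ℂ) volume := by
  refine fun x ↦ convolutionExistsAt_flip.1 (BddAbove.convolutionExistsAt _ (s := Set.univ)
    ⟨∫ ξ, ‖m ξ‖, ?_⟩ MeasurableSet.univ (Set.subset_univ _) hf.integrableOn
    (continuous_fourierInv_of_contDiff hm hc).aestronglyMeasurable)
  rintro _ ⟨y, -, rfl⟩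
  exact norm_fourierInv_le m y

/-- A multiplier bounded by `1` whose kernel is bounded by `A` maps `L^p` to `L^{p'}` with norm
`O(A ^ (2 / p - 1))`. -/
theorem eLpNorm_multiplierOp_le (hm : ContDiff ℝ (⊤ : ℕ∞) m) (hc : HasCompactSupport m)
    (hm1 : ∀ ξ, ‖m ξ‖ ≤ 1) {A : ℝ} (hA : ∀ x, ‖𝓕⁻ m x‖ ≤ A)
    {p : ℝ} (hp1 : 1 ≤ p) (hp2 : p ≤ 2) {q : ℝ≥0∞} (hpq : 1 / ENNReal.ofReal p + 1 / q = 1)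
    {f : V → ℂ} (hf : Integrable f) (hf2 : MemLp f 2) :
    eLpNorm (multiplierOp m f) q volume ≤
      ENNReal.ofReal (4 * A ^ (2 / p - 1)) * eLpNorm f (ENNReal.ofReal p) volume := by
  refine eLpNorm_le_of_one_of_two ((norm_nonneg _).trans (hA 0)) (fun f g hf hg ↦ ?_)
    (fun c f ↦ convolution_smul) (fun f hf x ↦ norm_multiplierOp_le hA hf x)
    (fun f hf hf2 ↦ ?_) hp1 hp2 hpq hf hf2
  · exact (convolutionExists_fourierInv hm hc hf).distrib_add
      (convolutionExists_fourierInv hm hc hg)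
  · have hT := memLp_two_multiplierOp hm hc hf
    refine ⟨hT, ?_⟩
    have h : eLpNorm (multiplierOp m f) 2 volume ≤ eLpNorm f 2 volume := by
      rw [← (memLp_fourier_and_eLpNorm_eq (integrable_multiplierOp hm hc hf) hT).2,
        ← (memLp_fourier_and_eLpNorm_eq hf hf2).2, fourier_multiplierOp hm hc hf]
      refine eLpNorm_mono fun ξ ↦ ?_
      rw [norm_mul]
      exact mul_le_of_le_one_left (norm_nonneg _) (hm1 ξ)
    rw [hT.eLpNorm_eq_integral_rpow_norm two_ne_zero (by simp),
      hf2.eLpNorm_eq_integral_rpow_norm two_ne_zero (by simp), ENNReal.toReal_ofNat,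
      ENNReal.ofReal_le_ofReal_iff (Real.rpow_nonneg (integral_nonneg fun _ ↦ by positivity) _)] at h
    exact (Real.rpow_le_rpow_iff (integral_nonneg fun _ ↦ by positivity)
      (integral_nonneg fun _ ↦ by positivity) (by norm_num)).1 h

end Multiplier

section Dispersive

variable {V : Type*} [NormedAddCommGroup V] [InnerProductSpace ℝ V] [FiniteDimensional ℝ V]

lemma exists_contDiff_annulus_cutoff : ∃ χ : V → ℝ, ContDiff ℝ (⊤ : ℕ∞) χ ∧
    (∀ ξ, 0 ≤ χ ξ ∧ χ ξ ≤ 1) ∧ (∀ ξ, 3 / 4 < ‖ξ‖ → ‖ξ‖ < 8 / 3 → χ ξ = 1) ∧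
    ∀ ξ, χ ξ ≠ 0 → 1 / 2 ≤ ‖ξ‖ ∧ ‖ξ‖ ≤ 3 := by
  let b₁ : ContDiffBump (0 : V) := ⟨8 / 3, 3, by norm_num, by norm_num⟩
  let b₂ : ContDiffBump (0 : V) := ⟨1 / 2, 3 / 4, by norm_num, by norm_num⟩
  refine ⟨fun ξ ↦ b₁ ξ * (1 - b₂ ξ), b₁.contDiff.mul (contDiff_const.sub b₂.contDiff),
    fun ξ ↦ ?_, fun ξ h1 h2 ↦ ?_, fun ξ h ↦ ?_⟩
  · have := b₁.nonneg' ξ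
    have := b₁.le_one (x := ξ)
    have := b₂.nonneg' ξ
    have := b₂.le_one (x := ξ)
    constructor <;> nlinarith
  · have e1 : b₁ ξ = 1 := b₁.one_of_mem_closedBall (by simpa using h2.le)
    have e2 : b₂ ξ = 0 := b₂.zero_of_le_dist (by simpa using h1.le)
    simp [e1, e2]
  · constructor <;> by_contra! hξ <;> apply h
    · have e2 : b₂ ξ = 1 := b₂.one_of_mem_closedBall (by simpa [b₂] using hξ.le)
      simp [e2]
    · have e1 : b₁ ξ = 0 := b₁.zero_of_le_dist (by simpa using hξ.le)
      simp [e1]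

/-- The multiplier of `e^{itΔ²}` localized by the dilated cutoff `χ (· / l)`. -/
def quarticMultiplier (χ : V → ℝ) (t l : ℝ) (ξ : V) : ℂ :=
  Complex.exp (Complex.I * t * ((‖ξ‖ ^ 4 : ℝ) : ℂ)) * (χ (l⁻¹ • ξ) : ℂ)

omit [FiniteDimensional ℝ V] in
lemma contDiff_ofReal_comp_smul {χ : V → ℝ} (hχ : ContDiff ℝ (⊤ : ℕ∞) χ) (l : ℝ) :
    ContDiff ℝ (⊤ : ℕ∞) fun ξ ↦ ((χ (l • ξ) : ℝ) : ℂ) :=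
  Complex.ofRealCLM.contDiff.comp (hχ.comp (contDiff_const_smul l))

lemma hasCompactSupport_ofReal_comp_smul {χ : V → ℝ} {R : ℝ} (hχ : ∀ ξ, χ ξ ≠ 0 → ‖ξ‖ ≤ R) {l : ℝ}
    (hl : 0 < l) : HasCompactSupport fun ξ ↦ ((χ (l⁻¹ • ξ) : ℝ) : ℂ) := by
  refine HasCompactSupport.intro (isCompact_closedBall (0 : V) (l * R)) fun ξ hξ ↦ ?_
  by_contra h
  have h' := hχ (l⁻¹ • ξ) (by exact_mod_cast h)
  rw [norm_smul, norm_inv, Real.norm_of_nonneg hl.le, inv_mul_le_iff₀ hl] at h'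
  exact hξ (by simpa using h')

omit [FiniteDimensional ℝ V] in
lemma contDiff_quarticMultiplier {χ : V → ℝ} (hχ : ContDiff ℝ (⊤ : ℕ∞) χ) (t l : ℝ) :
    ContDiff ℝ (⊤ : ℕ∞) (quarticMultiplier χ t l) := by
  have h4 : ContDiff ℝ (⊤ : ℕ∞) fun ξ : V ↦ ((‖ξ‖ ^ 4 : ℝ) : ℂ) := by
    have h : ContDiff ℝ (⊤ : ℕ∞) fun ξ : V ↦ (‖ξ‖ ^ 2) ^ 2 := (contDiff_norm_sq ℝ).pow 2
    simp only [← pow_mul] at h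
    exact Complex.ofRealCLM.contDiff.comp h
  exact (contDiff_const.mul h4).cexp.mul (contDiff_ofReal_comp_smul hχ _)

lemma hasCompactSupport_quarticMultiplier {χ : V → ℝ} {R : ℝ} (hχ : ∀ ξ, χ ξ ≠ 0 → ‖ξ‖ ≤ R)
    (t : ℝ) {l : ℝ} (hl : 0 < l) : HasCompactSupport (quarticMultiplier χ t l) :=
  (hasCompactSupport_ofReal_comp_smul hχ hl).mul_left

omit [FiniteDimensional ℝ V] in
lemma norm_quarticMultiplier_le_one {χ : V → ℝ} (hχ : ∀ ξ, 0 ≤ χ ξ ∧ χ ξ ≤ 1) (t l : ℝ) (ξ : V) :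
    ‖quarticMultiplier χ t l ξ‖ ≤ 1 := by
  rw [quarticMultiplier, norm_mul, show Complex.I * t * ((‖ξ‖ ^ 4 : ℝ) : ℂ) =
    ((t * ‖ξ‖ ^ 4 : ℝ) : ℂ) * Complex.I by push_cast; ring, Complex.norm_exp_ofReal_mul_I, one_mul,
    Complex.norm_real, Real.norm_of_nonneg (hχ _).1]
  exact (hχ _).2

variable [MeasurableSpace V] [BorelSpace V]

lemma fourierInv_quarticMultiplier (χ : V → ℝ) (t : ℝ) {l : ℝ} (hl : 0 < l) (x : V) :
    𝓕⁻ (quarticMultiplier χ t l) x = ((l ^ Module.finrank ℝ V : ℝ) : ℂ) *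
      ∫ ξ, Complex.exp (Complex.I * ((t * l ^ 4 : ℝ) * ‖ξ‖ ^ 4 +
        inner ℝ ξ ((2 * Real.pi * l) • x) : ℝ)) * (χ ξ : ℂ) := by
  have h := Measure.integral_comp_inv_smul_of_nonneg (volume : Measure V) (fun ξ ↦
    Complex.exp (Complex.I * ((t * l ^ 4 : ℝ) * ‖ξ‖ ^ 4 +
        inner ℝ ξ ((2 * Real.pi * l) • x) : ℝ)) * (χ ξ : ℂ)) hl.le
  rw [Complex.real_smul] at h
  rw [← h, Real.fourierInv_eq']
  refine integral_congr_ae (Filter.Eventually.of_forall fun ξ ↦ ?_)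
  simp only [quarticMultiplier, smul_eq_mul]
  rw [← mul_assoc, ← Complex.exp_add, norm_smul, norm_inv, Real.norm_of_nonneg hl.le,
    real_inner_smul_left, real_inner_smul_right]
  congr 2
  have : (l : ℂ) ≠ 0 := by exact_mod_cast hl.ne'
  push_cast
  field_simp
  ring

/-- The dispersive kernel bound `|K| ≲ (l² t)^{-n/2}` at frequency `l`. -/
lemma exists_norm_fourierInv_quarticMultiplier_le [Nontrivial V] {χ : V → ℝ}
    (hχ : ContDiff ℝ (⊤ : ℕ∞) χ) (hs : ∀ ξ, χ ξ ≠ 0 → 1 / 2 ≤ ‖ξ‖ ∧ ‖ξ‖ ≤ 3) :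
    ∃ C : ℝ, 1 ≤ C ∧ ∀ t l : ℝ, 0 < t → 0 < l → ∀ x,
      ‖𝓕⁻ (quarticMultiplier χ t l) x‖ ≤
        C * (l ^ 2 * t) ^ (-((Module.finrank ℝ V : ℝ) / 2)) := by
  obtain ⟨C, hC⟩ := exists_norm_integral_exp_quartic_le (χ := fun ξ ↦ (χ ξ : ℂ))
    (Complex.ofRealCLM.contDiff.comp hχ) fun ξ h ↦ hs ξ (by exact_mod_cast h)
  refine ⟨√(max C 1), Real.one_le_sqrt.2 (le_max_right _ _), fun t l ht hl x ↦ ?_⟩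
  set n := Module.finrank ℝ V with hn
  have hC' := hC (t * l ^ 4) (by positivity) ((2 * Real.pi * l) • x)
  rw [fourierInv_quarticMultiplier χ t hl, norm_mul, Complex.norm_real,
    Real.norm_of_nonneg (by positivity)]
  refine abs_le_of_sq_le_sq' ?_ (by positivity) |>.2
  rw [mul_pow, mul_pow, Real.sq_sqrt (by positivity), ← Real.rpow_natCast _ 2,
    ← Real.rpow_natCast (_ ^ (-((n : ℝ) / 2))) 2, ← Real.rpow_mul (by positivity)]
  have e : (-((n : ℝ) / 2) * ((2 : ℕ) : ℝ)) = -(n : ℝ) := by push_cast; ring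
  rw [e, Real.rpow_neg (by positivity), Real.rpow_natCast, Real.rpow_natCast]
  calc (l ^ n) ^ 2 * _ ≤ (l ^ n) ^ 2 * (max C 1 * ((t * l ^ 4) ^ n)⁻¹) := by
        gcongr
        refine hC'.trans ?_
        gcongr
        exact le_max_left _ _
    _ = max C 1 * ((l ^ 2 * t) ^ n)⁻¹ := by
        have h1 : (l ^ n) ^ 2 = (l ^ 2) ^ n := by rw [← pow_mul, ← pow_mul, mul_comm]
        rw [h1, show t * l ^ 4 = l ^ 2 * (l ^ 2 * t) by ring, mul_pow, mul_inv]
        have : (l ^ 2) ^ n ≠ 0 := by positivity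
        field_simp

lemma fourier_eq_zero_of_not_integrable {f : V → ℂ} (hf : ¬ Integrable f) : 𝓕 f = 0 := by
  ext ξ
  rw [Real.fourier_eq]
  exact integral_undef (by rwa [Real.fourierIntegral_convergent_iff])

/-- The frequency-localized dispersive estimate in dimension `n`, with the kernel bound `A`
entering to the power `2 / p - 1`. -/
lemma exists_eLpNorm_quartic_le [Nontrivial V] {φ : V → ℝ} (hφ : ContDiff ℝ (⊤ : ℕ∞) φ)
    (hsupp : ∀ ξ, φ ξ ≠ 0 → 3 / 4 < ‖ξ‖ ∧ ‖ξ‖ < 8 / 3) :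
    ∃ C : ℝ, 1 ≤ C ∧ ∀ l t p : ℝ, 0 < l → 0 < t → 1 ≤ p → p ≤ 2 →
      ∀ q : ℝ≥0∞, 1 / ENNReal.ofReal p + 1 / q = 1 → ∀ f : V → ℂ,
        eLpNorm (𝓕⁻ fun ξ ↦ Complex.exp (Complex.I * t * ((‖ξ‖ ^ 4 : ℝ) : ℂ)) *
          ((φ (l⁻¹ • ξ) : ℝ) : ℂ) * 𝓕 f ξ) q volume ≤
        ENNReal.ofReal (4 *
          (C * (l ^ 2 * t) ^ (-((Module.finrank ℝ V : ℝ) / 2))) ^ (2 / p - 1)) *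
          eLpNorm (𝓕⁻ fun ξ ↦ ((φ (l⁻¹ • ξ) : ℝ) : ℂ) * 𝓕 f ξ) (ENNReal.ofReal p) volume := by
  obtain ⟨χ, hχ, hχ01, hχ1, hχs⟩ := exists_contDiff_annulus_cutoff (V := V)
  obtain ⟨C, hC1, hC⟩ := exists_norm_fourierInv_quarticMultiplier_le hχ hχs
  refine ⟨C, hC1, fun l t p hl ht hp1 hp2 q hpq f ↦ ?_⟩
  by_cases hf : Integrable f
  · have hφs := contDiff_ofReal_comp_smul hφ l⁻¹
    have hφc := hasCompactSupport_ofReal_comp_smul (fun ξ h ↦ (hsupp ξ h).2.le) hl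
    have hms := contDiff_quarticMultiplier hχ t l
    have hmc := hasCompactSupport_quarticMultiplier (fun ξ h ↦ (hχs ξ h).2) t hl
    set u := multiplierOp (fun ξ ↦ ((φ (l⁻¹ • ξ) : ℝ) : ℂ)) f with hu
    have hui : Integrable u := integrable_multiplierOp hφs hφc hf
    have h : (fun ξ ↦ Complex.exp (Complex.I * t * ((‖ξ‖ ^ 4 : ℝ) : ℂ)) *
        ((φ (l⁻¹ • ξ) : ℝ) : ℂ) * 𝓕 f ξ) = fun ξ ↦ quarticMultiplier χ t l ξ * 𝓕 u ξ := by
      ext ξ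
      rw [hu, fourier_multiplierOp hφs hφc hf, quarticMultiplier]
      by_cases h0 : φ (l⁻¹ • ξ) = 0
      · simp [h0]
      · rw [hχ1 _ (hsupp _ h0).1 (hsupp _ h0).2]
        push_cast
        ring
    rw [h, fourierInv_mul_fourier hms hmc hui, fourierInv_mul_fourier hφs hφc hf]
    exact eLpNorm_multiplierOp_le hms hmc (norm_quarticMultiplier_le_one hχ01 t l)
      (hC t l ht hl) hp1 hp2 hpq hui (memLp_two_multiplierOp hφs hφc hf)
  · have h0 : (𝓕⁻ fun _ : V ↦ (0 : ℂ)) = 0 := by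
      ext x
      simp [Real.fourierInv_eq]
    simp [fourier_eq_zero_of_not_integrable hf, h0]

end Dispersive

/-- Frequency-localized dispersive estimate with gain for the fourth-order Schrödinger
propagator: for a dyadic bump `φ` supported in `{3/4 < |ξ| < 8/3}`, the Littlewood–Paley
piece `f_j = 𝓕⁻[φ(·/2^j) 𝓕 f]` satisfies, for `t > 1` and `1 ≤ p ≤ 2` with dual
exponent `q` (`1/p + 1/q = 1`),
`‖e^{itΔ²} f_j‖_{L^q} ≲ 2^{−5(2−p)j/p} t^{−5(2−p)/(2p)} ‖f_j‖_{L^p}`. -/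
theorem frequency_localized_dispersive (φ : E → ℝ) (hφ : ContDiff ℝ (⊤ : ℕ∞) φ)
    (hsupp : ∀ ξ : E, φ ξ ≠ 0 → 3 / 4 < ‖ξ‖ ∧ ‖ξ‖ < 8 / 3) :
    ∃ C : ℝ, 0 < C ∧ ∀ (j : ℤ) (t p : ℝ), 1 < t → 1 ≤ p → p ≤ 2 →
      ∀ q : ℝ≥0∞, 1 / ENNReal.ofReal p + 1 / q = 1 →
      ∀ f : E → ℂ,
        eLpNorm (𝓕⁻ fun ξ : E =>
            Complex.exp (Complex.I * (t : ℂ) * ((‖ξ‖ ^ 4 : ℝ) : ℂ)) *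
              ((φ ((((2 : ℝ) ^ j)⁻¹) • ξ) : ℝ) : ℂ) * 𝓕 f ξ) q volume ≤
          ENNReal.ofReal
              (C * (2 : ℝ) ^ (-(5 * (2 - p) * (j : ℝ)) / p) * t ^ (-(5 * (2 - p)) / (2 * p))) *
            eLpNorm (𝓕⁻ fun ξ : E => ((φ ((((2 : ℝ) ^ j)⁻¹) • ξ) : ℝ) : ℂ) * 𝓕 f ξ)
              (ENNReal.ofReal p) volume := by
  obtain ⟨C, hC1, hC⟩ := exists_eLpNorm_quartic_le hφ hsupp
  refine ⟨4 * C, by linarith, fun j t p ht hp1 hp2 q hpq f ↦ ?_⟩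
  have hp0 : 0 < p := by linarith
  have ht0 : 0 < t := by linarith
  have hl : (0 : ℝ) < 2 ^ j := by positivity
  refine (hC _ t p hl ht0 hp1 hp2 q hpq f).trans ?_
  gcongr ENNReal.ofReal ?_ * _
  have hθ0 : 0 ≤ 2 / p - 1 := by rw [sub_nonneg, one_le_div hp0]; exact hp2
  have hθ1 : 2 / p - 1 ≤ 1 := by rw [sub_le_iff_le_add, div_le_iff₀ hp0]; linarith
  have hCθ : C ^ (2 / p - 1) ≤ C := by
    simpa using Real.rpow_le_rpow_of_exponent_le hC1 hθ1
  have hl2 : ((2 : ℝ) ^ j) ^ 2 = (2 : ℝ) ^ (2 * (j : ℝ)) := by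
    rw [← Real.rpow_intCast, ← Real.rpow_natCast, ← Real.rpow_mul (by norm_num)]
    push_cast
    ring_nf
  have e : ((((2 : ℝ) ^ j) ^ 2 * t) ^ (-((Module.finrank ℝ E : ℝ) / 2))) ^ (2 / p - 1) =
      (2 : ℝ) ^ (-(5 * (2 - p) * (j : ℝ)) / p) * t ^ (-(5 * (2 - p)) / (2 * p)) := by
    rw [finrank_euclideanSpace_fin, hl2, ← Real.rpow_mul (by positivity),
      Real.mul_rpow (by positivity) ht0.le, ← Real.rpow_mul (by norm_num)]
    congr 2
    · push_cast
      field_simp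
    · push_cast
      field_simp
  rw [Real.mul_rpow (by linarith) (by positivity), e, mul_assoc (4 * C), mul_assoc 4 C]
  gcongr
end
end

section
/- (Linear dispersive estimate for the bilaplacian) For t > 0 and f with Fourier transform in L^∞ ∩ H³(ℝ⁵), one has ‖e^{itΔ²} f‖_{L^∞(ℝ⁵)} ≲ t^{−5/4} ‖F f‖_{L^∞} + t^{−11/8} ‖F f‖_{H³}. -/
open MeasureTheory ENNReal
open scoped FourierTransform

noncomputable section

local notation "E" => EuclideanSpace ℝ (Fin 5)

/-- A curve in the right half plane, asymptotic to the imaginary axis, along which `exp (i w² / 4)`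
stays bounded. -/
def contour (σ : ℝ) : ℂ := ((√(1 + σ ^ 2))⁻¹ : ℝ) - Complex.I * σ

/-- The velocity of `contour`. -/
def contourDeriv (σ : ℝ) : ℂ := (-σ / √(1 + σ ^ 2) ^ 3 : ℝ) - Complex.I

theorem hasDerivAt_contour (σ : ℝ) : HasDerivAt contour (contourDeriv σ) σ := by
  have hpos : 0 < 1 + σ ^ 2 := by positivity
  have h1 : HasDerivAt (fun s : ℝ => 1 + s ^ 2) (2 * σ) σ := by
    simpa using (hasDerivAt_pow 2 σ).const_add 1
  have h2 := ((h1.sqrt hpos.ne').inv (Real.sqrt_pos.2 hpos).ne').ofReal_comp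
  have h3 : HasDerivAt (fun s : ℝ => Complex.I * (s : ℂ)) Complex.I σ := by
    simpa using (hasDerivAt_id σ).ofReal_comp.const_mul Complex.I
  convert! h2.sub h3 using 1
  rw [contourDeriv]
  congr 2
  have := (Real.sqrt_pos.2 hpos).ne'
  field_simp

theorem continuous_contour : Continuous contour :=
  continuous_iff_continuousAt.2 fun σ => (hasDerivAt_contour σ).continuousAt

theorem continuous_contourDeriv : Continuous contourDeriv := by
  unfold contourDeriv
  have : ∀ σ : ℝ, √(1 + σ ^ 2) ^ 3 ≠ 0 := fun σ => by positivity
  fun_prop (disch := assumption)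

theorem norm_contourDeriv_le (σ : ℝ) : ‖contourDeriv σ‖ ≤ 2 := by
  have h1 : 1 ≤ √(1 + σ ^ 2) := Real.one_le_sqrt.2 (by nlinarith)
  have h2 : |σ| ≤ √(1 + σ ^ 2) := Real.abs_le_sqrt (by linarith)
  have h3 : |(-σ / √(1 + σ ^ 2) ^ 3)| ≤ 1 := by
    rw [abs_div, abs_neg, abs_of_pos (by positivity : 0 < √(1 + σ ^ 2) ^ 3),
      div_le_one (by positivity)]
    exact h2.trans (le_self_pow₀ h1 (by norm_num))
  calc ‖contourDeriv σ‖ ≤ ‖((-σ / √(1 + σ ^ 2) ^ 3 : ℝ) : ℂ)‖ + ‖Complex.I‖ := norm_sub_le _ _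
    _ ≤ 1 + 1 := by
      rw [Complex.norm_real, Complex.norm_I]
      gcongr
      exact h3
    _ = 2 := by norm_num

theorem contour_re (σ : ℝ) : (contour σ).re = (√(1 + σ ^ 2))⁻¹ := by simp [contour]

theorem contour_im (σ : ℝ) : (contour σ).im = -σ := by simp [contour]

theorem inv_sqrt_one_add_sq_le_one (σ : ℝ) : (√(1 + σ ^ 2))⁻¹ ≤ 1 :=
  inv_le_one_of_one_le₀ (Real.one_le_sqrt.2 (by nlinarith))

theorem abs_mul_inv_sqrt_one_add_sq_le_one (σ : ℝ) : |σ| * (√(1 + σ ^ 2))⁻¹ ≤ 1 := by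
  rw [← div_eq_mul_inv, div_le_one (by positivity)]
  exact Real.abs_le_sqrt (by linarith)

theorem norm_contour_ge (σ : ℝ) : √(1 + σ ^ 2) / 2 ≤ ‖contour σ‖ := by
  rw [Complex.norm_eq_sqrt_sq_add_sq, contour_re, contour_im]
  apply Real.le_sqrt_of_sq_le
  rw [div_pow, inv_pow, Real.sq_sqrt (by positivity)]
  have hpos : 0 < 1 + σ ^ 2 := by positivity
  have h : (1 + σ ^ 2) * (1 + σ ^ 2)⁻¹ = 1 := mul_inv_cancel₀ hpos.ne'
  have h' : 0 < (1 + σ ^ 2)⁻¹ := by positivity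
  nlinarith [sq_nonneg ((1 + σ ^ 2) - (1 + σ ^ 2)⁻¹), sq_nonneg ((1 + σ ^ 2) - 1),
    sq_nonneg ((1 + σ ^ 2)⁻¹ - 1)]

/-- The integrand in the subordination formula is uniformly bounded, with Gaussian decay, in the
region between the imaginary axis and `contour`. -/
theorem norm_cexp_sq_div_sub_mul_le {ε β σ S : ℝ} (hε : 0 < ε) (hε1 : ε ≤ 1) (hβ : 0 ≤ β)
    (hβ1 : β ≤ 1) (hβσ : |σ| * β ≤ 1) (hS : 0 ≤ S) :
    ‖Complex.exp ((β - Complex.I * σ) ^ 2 / (4 * (ε - Complex.I)) - S * (β - Complex.I * σ))‖ ≤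
      Real.exp 1 * Real.exp (-(ε / 8) * σ ^ 2) := by
  rw [Complex.norm_exp, ← Real.exp_add, Real.exp_le_exp]
  have hre : ((β - Complex.I * σ) ^ 2 / (4 * (ε - Complex.I)) - S * (β - Complex.I * σ)).re =
      (ε * (β ^ 2 - σ ^ 2) + 2 * σ * β) / (4 * (1 + ε ^ 2)) - S * β := by
    have hd : (ε - Complex.I : ℂ) ≠ 0 := fun h => by simpa [hε.ne'] using congrArg Complex.re h
    have : ((β - Complex.I * σ) ^ 2 / (4 * (ε - Complex.I)) : ℂ) =
        ((ε * (β ^ 2 - σ ^ 2) + 2 * σ * β) / (4 * (1 + ε ^ 2)) : ℝ) +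
        ((β ^ 2 - σ ^ 2 - 2 * ε * σ * β) / (4 * (1 + ε ^ 2)) : ℝ) * Complex.I := by
      have hd2 : (1 + ε ^ 2 : ℂ) ≠ 0 := by
        exact_mod_cast (by positivity : (1 + ε ^ 2 : ℝ) ≠ 0)
      push_cast
      field_simp
      ring_nf
      simp only [Complex.I_sq]
      ring
    rw [this]
    simp only [Complex.add_re, Complex.sub_re, Complex.ofReal_re, Complex.re_ofReal_mul,
      Complex.I_re, mul_zero, add_zero]
    simp
  rw [hre]
  have h1 : σ * β ≤ 1 := (mul_le_mul_of_nonneg_right (le_abs_self σ) hβ).trans hβσ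
  have h2 : ε * β ^ 2 ≤ 1 := mul_le_one₀ hε1 (by positivity) (pow_le_one₀ hβ hβ1)
  have h3 : 0 ≤ S * β := by positivity
  have h4 : (ε * (β ^ 2 - σ ^ 2) + 2 * σ * β) / (4 * (1 + ε ^ 2)) ≤ 1 + -(ε / 8) * σ ^ 2 := by
    rw [div_le_iff₀ (by positivity)]
    have : ε ^ 2 ≤ 1 := pow_le_one₀ hε.le hε1
    have : 0 ≤ ε * σ ^ 2 * (1 - ε ^ 2) := by
      apply mul_nonneg (by positivity); linarith
    nlinarith [sq_nonneg ε]
  linarith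

theorem norm_cexp_contour_le {ε S : ℝ} (hε : 0 < ε) (hε1 : ε ≤ 1) (hS : 0 ≤ S) (σ : ℝ) :
    ‖Complex.exp (contour σ ^ 2 / (4 * (ε - Complex.I)) - S * contour σ)‖ ≤
      Real.exp 1 * Real.exp (-(ε / 8) * σ ^ 2) :=
  norm_cexp_sq_div_sub_mul_le hε hε1 (by positivity) (inv_sqrt_one_add_sq_le_one σ)
    (abs_mul_inv_sqrt_one_add_sq_le_one σ) hS

theorem integral_cexp_contour_eq_integral_cexp_imaginary {ε S : ℝ} (hε : 0 < ε) (hε1 : ε ≤ 1)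
    (hS : 0 ≤ S) :
    ∫ σ : ℝ, Complex.exp (contour σ ^ 2 / (4 * (ε - Complex.I)) - S * contour σ) *
        contourDeriv σ =
      ∫ σ : ℝ, Complex.exp ((-Complex.I * σ) ^ 2 / (4 * (ε - Complex.I)) -
        S * (-Complex.I * σ)) * (-Complex.I) := by
  set h : ℂ → ℂ := fun w => Complex.exp (w ^ 2 / (4 * (ε - Complex.I)) - S * w) with hh
  have hd : Differentiable ℂ h := by fun_prop
  obtain ⟨H, hH⟩ := hd.isExactOn_univ
  replace hH : ∀ w, HasDerivAt H (h w) w := fun w => hH w trivial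
  have hHc : Continuous H := continuous_iff_continuousAt.2 fun w => (hH w).continuousAt
  have hgauss : Integrable fun σ : ℝ => Real.exp 1 * Real.exp (-(ε / 8) * σ ^ 2) :=
    (integrable_exp_neg_mul_sq (by positivity)).const_mul _
  have hline : ∀ σ : ℝ, HasDerivAt (fun s : ℝ => -Complex.I * (s : ℂ)) (-Complex.I) σ := fun σ => by
    simpa using (hasDerivAt_id σ).ofReal_comp.const_mul (-Complex.I)
  have hb : ∀ (σ β : ℝ), 0 ≤ β → β ≤ (√(1 + σ ^ 2))⁻¹ → ‖h (β - Complex.I * σ)‖ ≤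
      Real.exp 1 * Real.exp (-(ε / 8) * σ ^ 2) := fun σ β h0 h1 =>
    norm_cexp_sq_div_sub_mul_le hε hε1 h0 (h1.trans (inv_sqrt_one_add_sq_le_one σ))
      ((mul_le_mul_of_nonneg_left h1 (abs_nonneg σ)).trans (abs_mul_inv_sqrt_one_add_sq_le_one σ)) hS
  have hi1 : Integrable fun σ : ℝ => h (contour σ) * contourDeriv σ := by
    refine (hgauss.mul_const 2).mono' ?_ (ae_of_all _ fun σ => ?_)
    · exact ((hd.continuous.comp continuous_contour).mul
        continuous_contourDeriv).aestronglyMeasurable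
    · rw [norm_mul]
      gcongr
      · exact hb σ _ (by positivity) le_rfl
      · exact norm_contourDeriv_le σ
  have hi2 : Integrable fun σ : ℝ => h (-Complex.I * σ) * (-Complex.I) := by
    refine hgauss.mono' ?_ (ae_of_all _ fun σ => ?_)
    · exact (Continuous.mul (hd.continuous.comp (by fun_prop))
        continuous_const).aestronglyMeasurable
    · rw [norm_mul, norm_neg, Complex.norm_I, mul_one]
      simpa using hb σ 0 le_rfl (by positivity)
  have hderiv : ∀ σ : ℝ, HasDerivAt (fun s : ℝ => H (contour s) - H (-Complex.I * s))
      (h (contour σ) * contourDeriv σ - h (-Complex.I * σ) * (-Complex.I)) σ := fun σ =>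
    ((hH _).comp σ (hasDerivAt_contour σ)).sub ((hH _).comp σ (hline σ))
  have hi3 : Integrable fun σ : ℝ => H (contour σ) - H (-Complex.I * σ) := by
    refine hgauss.mono' ?_ (ae_of_all _ fun σ => ?_)
    · exact ((hHc.comp continuous_contour).sub (hHc.comp (by fun_prop))).aestronglyMeasurable
    · have hder : ∀ β ∈ Set.Icc (0 : ℝ) (√(1 + σ ^ 2))⁻¹,
          HasDerivWithinAt (fun β : ℝ => H (β - Complex.I * σ)) (h (β - Complex.I * σ))
            (Set.Icc (0 : ℝ) (√(1 + σ ^ 2))⁻¹) β := fun β _ => by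
        have := (hH (β - Complex.I * σ)).comp β
          ((hasDerivAt_id β).ofReal_comp.sub_const (Complex.I * σ))
        rw [Complex.ofReal_one, mul_one] at this
        exact this.hasDerivWithinAt
      have := Convex.norm_image_sub_le_of_norm_hasDerivWithin_le hder
        (fun β hβ => hb σ β hβ.1 hβ.2) (convex_Icc _ _)
        (Set.left_mem_Icc.2 (by positivity)) (Set.right_mem_Icc.2 (by positivity))
      rw [sub_zero, Real.norm_of_nonneg (by positivity)] at this
      have h0 : ((0 : ℝ) : ℂ) - Complex.I * σ = -Complex.I * σ := by simp
      rw [h0] at this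
      refine this.trans (mul_le_of_le_one_right (by positivity) (inv_sqrt_one_add_sq_le_one σ))
  rw [← sub_eq_zero, ← integral_sub hi1 hi2]
  exact integral_eq_zero_of_hasDerivAt_of_integrable hderiv (hi1.sub hi2) hi3

/-- Subordination of `exp (-(ε - i) S²)` to the exponentials `exp (-S w)`, `0 < re w`. -/
theorem integral_cexp_contour {ε S : ℝ} (hε : 0 < ε) (hε1 : ε ≤ 1) (hS : 0 ≤ S) :
    ∫ σ : ℝ, Complex.exp (contour σ ^ 2 / (4 * (ε - Complex.I)) - S * contour σ) *
        contourDeriv σ =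
      -Complex.I * (4 * Real.pi * (ε - Complex.I)) ^ (1 / 2 : ℂ) *
        Complex.exp (-(ε - Complex.I) * S ^ 2) := by
  rw [integral_cexp_contour_eq_integral_cexp_imaginary hε hε1 hS, integral_mul_const]
  have hz : (ε - Complex.I : ℂ) ≠ 0 := fun h => by simpa [hε.ne'] using congrArg Complex.re h
  have hb : 0 < (1 / (4 * (ε - Complex.I)) : ℂ).re := by
    rw [one_div, Complex.inv_re]
    apply div_pos _ (Complex.normSq_pos.2 (by simpa using hz))
    simpa using hε
  have := fourierIntegral_gaussian hb S
  calc _ = (∫ x : ℝ, Complex.exp (Complex.I * S * x) *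
        Complex.exp (-(1 / (4 * (ε - Complex.I))) * x ^ 2)) * (-Complex.I) := by
        congr 2 with σ
        rw [← Complex.exp_add]
        congr 1
        rw [mul_pow, neg_sq, Complex.I_sq]
        ring
    _ = _ := by
      rw [this]
      have e1 : (Real.pi / (1 / (4 * (ε - Complex.I))) : ℂ) =
        4 * Real.pi * (ε - Complex.I) := by field_simp
      have e2 : (-(S : ℂ) ^ 2 / (4 * (1 / (4 * (ε - Complex.I))))) =
        -(ε - Complex.I) * S ^ 2 := by field_simp
      rw [e1, e2]
      ring

theorem norm_cexp_neg_mul_sq_sub_le {c : ℂ} (hc : 0 < c.re) (r s : ℝ) :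
    ‖Complex.exp (-c * (r : ℂ) ^ 2) - Complex.exp (-c * (s : ℂ) ^ 2)‖ ≤
      ‖c‖ / √c.re * |r - s| := by
  have hder : ∀ u ∈ (Set.univ : Set ℝ), HasDerivWithinAt
      (fun u : ℝ => Complex.exp (-c * (u : ℂ) ^ 2))
      (Complex.exp (-c * (u : ℂ) ^ 2) * (-c * (2 * u))) Set.univ u := fun u _ => by
    have h1 : HasDerivAt (fun z : ℂ => Complex.exp (-c * z ^ 2))
        (Complex.exp (-c * (u : ℂ) ^ 2) * (-c * (2 * u))) (u : ℂ) := by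
      simpa using ((hasDerivAt_pow 2 (u : ℂ)).const_mul (-c)).cexp
    exact h1.comp_ofReal.hasDerivWithinAt
  refine convex_univ.norm_image_sub_le_of_norm_hasDerivWithin_le hder (fun u _ => ?_) trivial
    trivial
  have hre : (-c * (u : ℂ) ^ 2).re = -(c.re * u ^ 2) := by
    rw [← Complex.ofReal_pow, Complex.re_mul_ofReal, Complex.neg_re, neg_mul]
  rw [norm_mul, norm_mul, norm_mul, norm_neg, Complex.norm_exp, hre, Complex.norm_real,
    Real.norm_eq_abs, Complex.norm_ofNat, Real.exp_neg]
  have hs : 0 < √c.re := Real.sqrt_pos.2 hc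
  have hsq : √c.re ^ 2 = c.re := Real.sq_sqrt hc.le
  have hexp : 2 * (√c.re * |u|) ≤ Real.exp (c.re * u ^ 2) := by
    have := Real.add_one_le_exp (c.re * u ^ 2)
    have h2 : (√c.re * |u|) ^ 2 = c.re * u ^ 2 := by rw [mul_pow, hsq, sq_abs]
    nlinarith [sq_nonneg (√c.re * |u| - 1)]
  rw [inv_mul_le_iff₀ (Real.exp_pos _), mul_div_assoc', le_div_iff₀ hs]
  nlinarith [mul_le_mul_of_nonneg_left hexp (norm_nonneg c)]

theorem integral_fourier_mul_gaussian {f : E → ℂ} (hf : Integrable f) {W : ℂ} (hW : 0 < W.re)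
    (x : E) :
    ∫ ξ, 𝓕 f ξ * Complex.exp (-W * ‖ξ‖ ^ 2 + 2 * Real.pi * Complex.I * inner ℝ x ξ) =
      (Real.pi / W) ^ (5 / 2 : ℂ) *
        ∫ y, f y * Complex.exp (-(Real.pi ^ 2 / W) * ‖x - y‖ ^ 2) := by
  have hg : Integrable fun ξ : E =>
      Complex.exp (-W * ‖ξ‖ ^ 2 + 2 * Real.pi * Complex.I * inner ℝ x ξ) :=
    GaussianFourier.integrable_cexp_neg_mul_sq_norm_add hW _ x
  have h := VectorFourier.integral_fourierIntegral_smul_eq_flip (L := innerₗ E)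
    Real.continuous_fourierChar continuous_inner hf hg
  rw [flip_innerₗ] at h
  simp only [smul_eq_mul] at h
  refine h.trans ?_
  rw [← integral_const_mul]
  congr 1 with y
  have := fourier_gaussian_innerProductSpace' hW x y
  rw [finrank_euclideanSpace_fin] at this
  refine (congrArg (f y * ·) this).trans ?_
  push_cast
  rw [show -(Real.pi : ℂ) ^ 2 * ‖x - y‖ ^ 2 / W = -(Real.pi ^ 2 / W) * ‖x - y‖ ^ 2 by ring]
  ring

theorem integrable_norm_mul_min {f : E → ℂ} (hf : Integrable f) (R : ℝ) (hR : 0 ≤ R) :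
    Integrable fun y => ‖f y‖ * min 1 (‖y‖ / R) := by
  refine hf.norm.mul_bdd (c := 1) ?_ (ae_of_all _ fun y => ?_)
  · exact (by fun_prop : Continuous fun y : E => min 1 (‖y‖ / R)).aestronglyMeasurable
  · rw [Real.norm_of_nonneg (by positivity)]
    exact min_le_left _ _

theorem norm_integral_mul_gaussian_le {f : E → ℂ} (hf : Integrable f) {c : ℂ} (hc : 0 < c.re)
    {R a : ℝ} (hR : 0 < R) (ha : 1 ≤ a) (hca : ‖c‖ / √c.re ≤ Real.pi * a / R) (x : E) :
    ‖∫ y, f y * Complex.exp (-c * ‖x - y‖ ^ 2)‖ ≤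
      Real.pi * a * (‖𝓕 f 0‖ + ∫ y, ‖f y‖ * min 1 (‖y‖ / R)) := by
  have hle1 : ∀ v : E, ‖Complex.exp (-c * ‖v‖ ^ 2)‖ ≤ 1 := fun v => by
    rw [Complex.norm_exp, ← Complex.ofReal_pow, Complex.re_mul_ofReal, Complex.neg_re, neg_mul]
    exact Real.exp_le_one_iff.2 (neg_nonpos.2 (by positivity))
  have hpi : 2 ≤ Real.pi := Real.two_le_pi
  have hpia : 2 ≤ Real.pi * a := by nlinarith
  have hi1 : Integrable fun y => f y * Complex.exp (-c * ‖x - y‖ ^ 2) :=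
    hf.mul_bdd (c := 1) (by fun_prop : Continuous fun y : E =>
      Complex.exp (-c * ‖x - y‖ ^ 2)).aestronglyMeasurable (ae_of_all _ fun y => hle1 _)
  have hi2 : Integrable fun y => f y * Complex.exp (-c * ‖x‖ ^ 2) := hf.mul_const _
  have hF : ∫ y, f y = 𝓕 f 0 := by simp [Real.fourier_eq]
  have hsplit : ∫ y, f y * Complex.exp (-c * ‖x - y‖ ^ 2) =
      𝓕 f 0 * Complex.exp (-c * ‖x‖ ^ 2) +
        ∫ y, f y * (Complex.exp (-c * ‖x - y‖ ^ 2) - Complex.exp (-c * ‖x‖ ^ 2)) := by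
    simp only [mul_sub]
    rw [integral_sub hi1 hi2, integral_mul_const, hF]
    ring
  have hdiff : ∀ y, ‖f y * (Complex.exp (-c * ‖x - y‖ ^ 2) - Complex.exp (-c * ‖x‖ ^ 2))‖ ≤
      Real.pi * a * (‖f y‖ * min 1 (‖y‖ / R)) := fun y => by
    have h1 : ‖Complex.exp (-c * ‖x - y‖ ^ 2) - Complex.exp (-c * ‖x‖ ^ 2)‖ ≤
        Real.pi * a * 1 :=
      (norm_sub_le _ _).trans (by linarith [hle1 (x - y), hle1 x])
    have h2 : ‖Complex.exp (-c * ‖x - y‖ ^ 2) - Complex.exp (-c * ‖x‖ ^ 2)‖ ≤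
        Real.pi * a * (‖y‖ / R) := by
      refine (norm_cexp_neg_mul_sq_sub_le hc _ _).trans ?_
      have h3 : |‖x - y‖ - ‖x‖| ≤ ‖y‖ := by
        simpa using abs_norm_sub_norm_le (x - y) x
      calc ‖c‖ / √c.re * |‖x - y‖ - ‖x‖| ≤ Real.pi * a / R * ‖y‖ := by gcongr
        _ = _ := by ring
    rw [norm_mul]
    calc _ ≤ ‖f y‖ * (Real.pi * a * min 1 (‖y‖ / R)) := by
          gcongr
          rw [mul_min_of_nonneg _ _ (by positivity)]
          exact le_min h1 h2
      _ = _ := by ring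
  have hm := (integrable_norm_mul_min hf R hR.le).const_mul (Real.pi * a)
  have h4 := norm_integral_le_of_norm_le hm (ae_of_all _ hdiff)
  rw [integral_const_mul] at h4
  rw [hsplit, mul_add]
  refine (norm_add_le _ _).trans (add_le_add ?_ h4)
  rw [norm_mul]
  calc _ ≤ ‖𝓕 f 0‖ * 1 := by gcongr; exact hle1 x
    _ ≤ _ := by nlinarith [norm_nonneg (𝓕 f 0)]

/-- Bound for the heat flow at the complex time `R² w` with `w` on the contour. -/
theorem norm_integral_fourier_mul_gaussian_le {f : E → ℂ} (hf : Integrable f) {R : ℝ}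
    (hR : 0 < R) (σ : ℝ) (x : E) :
    ‖∫ ξ, 𝓕 f ξ * Complex.exp (-(contour σ * (R ^ 2 : ℝ)) * ‖ξ‖ ^ 2 +
        2 * Real.pi * Complex.I * inner ℝ x ξ)‖ ≤
      √(2 * Real.pi) ^ 5 * Real.pi * (R ^ 5)⁻¹ *
        (‖𝓕 f 0‖ + ∫ y, ‖f y‖ * min 1 (‖y‖ / R)) * (1 + σ ^ 2)⁻¹ := by
  set W : ℂ := contour σ * (R ^ 2 : ℝ) with hWdef
  set a : ℝ := √√(1 + σ ^ 2) with hadef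
  have hA : 1 ≤ √(1 + σ ^ 2) := Real.one_le_sqrt.2 (by nlinarith)
  have ha : 1 ≤ a := Real.one_le_sqrt.2 hA
  have ha2 : a ^ 2 = √(1 + σ ^ 2) := Real.sq_sqrt (by positivity)
  have ha4 : a ^ 4 = 1 + σ ^ 2 := by
    rw [show a ^ 4 = (a ^ 2) ^ 2 by ring, ha2, Real.sq_sqrt (by positivity)]
  have hWre : W.re = (R / a) ^ 2 := by
    rw [hWdef, Complex.re_mul_ofReal, contour_re, div_pow, ha2]
    ring
  have hW : 0 < W.re := by rw [hWre]; positivity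
  have hW0 : W ≠ 0 := fun h => by simp [h] at hW
  have hWn : 0 < ‖W‖ := norm_pos_iff.2 hW0
  have hWnorm : (R * a) ^ 2 / 2 ≤ ‖W‖ := by
    rw [hWdef, norm_mul, Complex.norm_real, Real.norm_of_nonneg (by positivity), mul_pow, ha2]
    nlinarith [norm_contour_ge σ, sq_nonneg R]
  have hcre : (Real.pi ^ 2 / W : ℂ).re = (Real.pi / ‖W‖ * (R / a)) ^ 2 := by
    rw [div_eq_mul_inv, ← Complex.ofReal_pow, Complex.re_ofReal_mul, Complex.inv_re, hWre,
      Complex.normSq_eq_norm_sq]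
    ring
  have hc : 0 < (Real.pi ^ 2 / W : ℂ).re := by rw [hcre]; positivity
  have hca : ‖(Real.pi ^ 2 / W : ℂ)‖ / √(Real.pi ^ 2 / W : ℂ).re ≤ Real.pi * a / R := by
    rw [hcre, Real.sqrt_sq (by positivity), norm_div, norm_pow, Complex.norm_real,
      Real.norm_of_nonneg Real.pi_pos.le]
    apply le_of_eq
    field_simp
  have hpow : ‖(Real.pi / W : ℂ) ^ (5 / 2 : ℂ)‖ ≤ (√(2 * Real.pi) / (R * a)) ^ 5 := by
    have h52 : (5 / 2 : ℂ) = ((5 / 2 : ℝ) : ℂ) := by push_cast; rfl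
    rw [h52, Complex.norm_cpow_real, norm_div, Complex.norm_real,
      Real.norm_of_nonneg Real.pi_pos.le]
    have h1 : Real.pi / ‖W‖ ≤ (√(2 * Real.pi) / (R * a)) ^ 2 := by
      rw [div_pow, Real.sq_sqrt (by positivity), div_le_div_iff₀ hWn (by positivity)]
      nlinarith [Real.pi_pos]
    calc (Real.pi / ‖W‖) ^ (5 / 2 : ℝ) ≤ ((√(2 * Real.pi) / (R * a)) ^ 2) ^ (5 / 2 : ℝ) := by
          gcongr
      _ = (√(2 * Real.pi) / (R * a)) ^ 5 := by
          rw [← Real.rpow_natCast, ← Real.rpow_mul (by positivity), ← Real.rpow_natCast]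
          norm_num
  rw [integral_fourier_mul_gaussian hf hW, norm_mul]
  have hM : 0 ≤ ∫ y, ‖f y‖ * min 1 (‖y‖ / R) := integral_nonneg fun y => by positivity
  calc _ ≤ (√(2 * Real.pi) / (R * a)) ^ 5 *
        (Real.pi * a * (‖𝓕 f 0‖ + ∫ y, ‖f y‖ * min 1 (‖y‖ / R))) := by
        gcongr
        exact norm_integral_mul_gaussian_le hf hc hR ha hca x
    _ = _ := by
      rw [← ha4]
      field_simp

theorem continuous_fourier_of_integrable_s11 {f : E → ℂ} (hf : Integrable f) : Continuous (𝓕 f) :=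
  VectorFourier.fourierIntegral_continuous (L := innerₗ E) Real.continuous_fourierChar
    continuous_inner hf

theorem norm_integral_fourier_mul_cexp_le {f : E → ℂ} (hf : Integrable f) (hg : Integrable (𝓕 f))
    {ε R : ℝ} (hε : 0 < ε) (hε1 : ε ≤ 1) (hR : 0 < R) (x : E) :
    ‖∫ ξ, 𝓕 f ξ * Complex.exp (-(ε - Complex.I) * ((R ^ 2 * ‖ξ‖ ^ 2 : ℝ) : ℂ) ^ 2 +
        2 * Real.pi * Complex.I * inner ℝ x ξ)‖ ≤
      Real.exp 1 * 2 * (√(2 * Real.pi) ^ 5 * Real.pi * (R ^ 5)⁻¹ *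
        (‖𝓕 f 0‖ + ∫ y, ‖f y‖ * min 1 (‖y‖ / R))) * Real.pi := by
  set B := √(2 * Real.pi) ^ 5 * Real.pi * (R ^ 5)⁻¹ *
    (‖𝓕 f 0‖ + ∫ y, ‖f y‖ * min 1 (‖y‖ / R)) with hB
  have hB0 : 0 ≤ B := by
    have hM : 0 ≤ ∫ y, ‖f y‖ * min 1 (‖y‖ / R) := integral_nonneg fun y => by positivity
    positivity
  set Z : ℂ := ε - Complex.I with hZ
  have hfc : Continuous (𝓕 f) := continuous_fourier_of_integrable_s11 hf
  set G : E → ℂ := fun ξ => 𝓕 f ξ * Complex.exp (2 * Real.pi * Complex.I * inner ℝ x ξ) with hG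
  have hGn : ∀ ξ, ‖G ξ‖ = ‖𝓕 f ξ‖ := fun ξ => by
    rw [hG, norm_mul, Complex.norm_exp]
    simp
  have hGc : Continuous G := by fun_prop
  set k : E → ℝ → ℂ := fun ξ σ => Complex.exp (contour σ ^ 2 / (4 * Z) -
    ((R ^ 2 * ‖ξ‖ ^ 2 : ℝ) : ℂ) * contour σ) * contourDeriv σ with hk
  have hcc := continuous_contour
  have hcd := continuous_contourDeriv
  have hgauss : Integrable fun σ : ℝ => Real.exp 1 * Real.exp (-(ε / 8) * σ ^ 2) * 2 :=
    ((integrable_exp_neg_mul_sq (by positivity)).const_mul _).mul_const _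
  have hkn : ∀ ξ σ, ‖k ξ σ‖ ≤ Real.exp 1 * Real.exp (-(ε / 8) * σ ^ 2) * 2 := fun ξ σ => by
    rw [hk, norm_mul]
    gcongr
    · exact norm_cexp_contour_le hε hε1 (by positivity) σ
    · exact norm_contourDeriv_le σ
  have hint : Integrable (Function.uncurry fun ξ σ => G ξ * k ξ σ)
      ((volume : Measure E).prod (volume : Measure ℝ)) := by
    refine (hg.norm.mul_prod hgauss).mono' ?_ (ae_of_all _ fun p => ?_)
    · apply Continuous.aestronglyMeasurable
      simp only [hk, Function.uncurry_def]
      fun_prop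
    · rw [Function.uncurry_apply_pair, norm_mul, hGn]
      gcongr
      exact hkn _ _
  have hswap := integral_integral_swap hint
  have hleft : ∫ ξ, ∫ σ, G ξ * k ξ σ = -Complex.I * (4 * Real.pi * Z) ^ (1 / 2 : ℂ) *
      ∫ ξ, 𝓕 f ξ * Complex.exp (-Z * ((R ^ 2 * ‖ξ‖ ^ 2 : ℝ) : ℂ) ^ 2 +
        2 * Real.pi * Complex.I * inner ℝ x ξ) := by
    rw [← integral_const_mul]
    congr 1 with ξ
    rw [integral_const_mul, hk, integral_cexp_contour hε hε1 (by positivity), hG, Complex.exp_add]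
    ring
  have hright : ∀ σ, ‖∫ ξ, G ξ * k ξ σ‖ ≤ Real.exp 1 * 2 * B * (1 + σ ^ 2)⁻¹ := fun σ => by
    have : ∫ ξ, G ξ * k ξ σ = Complex.exp (contour σ ^ 2 / (4 * Z)) * contourDeriv σ *
        ∫ ξ, 𝓕 f ξ * Complex.exp (-(contour σ * (R ^ 2 : ℝ)) * ‖ξ‖ ^ 2 +
          2 * Real.pi * Complex.I * inner ℝ x ξ) := by
      rw [← integral_const_mul]
      congr 1 with ξ
      simp only [hG, hk]
      rw [Complex.exp_add, Complex.exp_sub, div_eq_mul_inv, ← Complex.exp_neg]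
      push_cast
      rw [show -((R : ℂ) ^ 2 * (‖ξ‖ : ℂ) ^ 2 * contour σ) =
        -(contour σ * (R : ℂ) ^ 2) * (‖ξ‖ : ℂ) ^ 2 by ring]
      ring
    rw [this, norm_mul, norm_mul, mul_assoc _ B]
    have he : ‖Complex.exp (contour σ ^ 2 / (4 * Z))‖ ≤ Real.exp 1 := by
      have := norm_cexp_contour_le hε hε1 le_rfl σ
      rw [Complex.ofReal_zero, zero_mul, sub_zero] at this
      refine this.trans (mul_le_of_le_one_right (by positivity) (Real.exp_le_one_iff.2 ?_))
      nlinarith [sq_nonneg σ]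
    gcongr
    · exact norm_contourDeriv_le σ
    · exact norm_integral_fourier_mul_gaussian_le hf hR σ x
  have hone : 1 ≤ ‖-Complex.I * (4 * Real.pi * Z) ^ (1 / 2 : ℂ)‖ := by
    have h12 : (1 / 2 : ℂ) = ((1 / 2 : ℝ) : ℂ) := by push_cast; rfl
    rw [norm_mul, norm_neg, Complex.norm_I, one_mul, h12, Complex.norm_cpow_real]
    apply Real.one_le_rpow _ (by norm_num)
    have h1 : 1 ≤ ‖Z‖ := by
      have := Complex.abs_im_le_norm Z
      simpa [hZ] using this
    rw [norm_mul, norm_mul, Complex.norm_real, Real.norm_of_nonneg Real.pi_pos.le,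
      Complex.norm_ofNat]
    nlinarith [Real.two_le_pi]
  have hfinal := norm_integral_le_of_norm_le
    (integrable_inv_one_add_sq.const_mul (Real.exp 1 * 2 * B)) (ae_of_all _ hright)
  rw [integral_const_mul, integral_univ_inv_one_add_sq, ← hswap, hleft, norm_mul] at hfinal
  exact (le_mul_of_one_le_left (norm_nonneg _) hone).trans hfinal

/-- The dispersive estimate with the error measured by a truncated first moment of `f`. -/
theorem norm_fourierInv_cexp_mul_fourier_le {f : E → ℂ} (hf : Integrable f)
    (hg : Integrable (𝓕 f)) {R : ℝ} (hR : 0 < R) (x : E) :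
    ‖𝓕⁻ (fun ξ : E =>
        Complex.exp (Complex.I * ((R ^ 4 : ℝ) : ℂ) * ((‖ξ‖ ^ 4 : ℝ) : ℂ)) * 𝓕 f ξ) x‖ ≤
      Real.exp 1 * 2 * (√(2 * Real.pi) ^ 5 * Real.pi * (R ^ 5)⁻¹ *
        (‖𝓕 f 0‖ + ∫ y, ‖f y‖ * min 1 (‖y‖ / R))) * Real.pi := by
  have hfc : Continuous (𝓕 f) := continuous_fourier_of_integrable_s11 hf
  have hlim : Filter.Tendsto (fun ε : ℝ => ∫ ξ, 𝓕 f ξ * Complex.exp (-(ε - Complex.I) *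
        ((R ^ 2 * ‖ξ‖ ^ 2 : ℝ) : ℂ) ^ 2 + 2 * Real.pi * Complex.I * inner ℝ x ξ))
      (nhdsWithin 0 (Set.Ioi 0))
      (nhds (∫ ξ, 𝓕 f ξ * Complex.exp (-(((0 : ℝ) : ℂ) - Complex.I) *
        ((R ^ 2 * ‖ξ‖ ^ 2 : ℝ) : ℂ) ^ 2 + 2 * Real.pi * Complex.I * inner ℝ x ξ))) := by
    refine tendsto_integral_filter_of_dominated_convergence (fun ξ => ‖𝓕 f ξ‖) ?_ ?_ hg.norm ?_
    · filter_upwards with ε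
      apply Continuous.aestronglyMeasurable
      fun_prop
    · filter_upwards [self_mem_nhdsWithin] with ε hε
      refine ae_of_all _ fun ξ => ?_
      rw [norm_mul, Complex.norm_exp]
      refine mul_le_of_le_one_right (norm_nonneg _) (Real.exp_le_one_iff.2 ?_)
      rw [← Complex.ofReal_pow, Complex.add_re, Complex.re_mul_ofReal]
      have : 0 ≤ ε * (R ^ 2 * ‖ξ‖ ^ 2) ^ 2 := mul_nonneg (le_of_lt hε) (by positivity)
      simpa using this
    · refine ae_of_all _ fun ξ => ?_
      apply Filter.Tendsto.mono_left _ nhdsWithin_le_nhds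
      exact (by fun_prop : Continuous fun ε : ℝ => 𝓕 f ξ * Complex.exp (-(ε - Complex.I) *
        ((R ^ 2 * ‖ξ‖ ^ 2 : ℝ) : ℂ) ^ 2 + 2 * Real.pi * Complex.I * inner ℝ x ξ)).tendsto 0
  have heq : 𝓕⁻ (fun ξ : E =>
        Complex.exp (Complex.I * ((R ^ 4 : ℝ) : ℂ) * ((‖ξ‖ ^ 4 : ℝ) : ℂ)) * 𝓕 f ξ) x =
      ∫ ξ, 𝓕 f ξ * Complex.exp (-(((0 : ℝ) : ℂ) - Complex.I) *
        ((R ^ 2 * ‖ξ‖ ^ 2 : ℝ) : ℂ) ^ 2 + 2 * Real.pi * Complex.I * inner ℝ x ξ) := by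
    rw [Real.fourierInv_eq']
    congr 1 with ξ
    rw [Complex.exp_add, smul_eq_mul, real_inner_comm]
    push_cast
    rw [show -(0 - Complex.I) * ((R : ℂ) ^ 2 * (‖ξ‖ : ℂ) ^ 2) ^ 2 =
      Complex.I * (R : ℂ) ^ 4 * (‖ξ‖ : ℂ) ^ 4 by ring,
      show (2 * Real.pi * (inner ℝ x ξ : ℝ) * Complex.I : ℂ) =
        2 * Real.pi * Complex.I * (inner ℝ x ξ : ℝ) by ring]
    ring
  rw [heq]
  refine le_of_tendsto hlim.norm ?_
  filter_upwards [Ioc_mem_nhdsGT one_pos] with ε hε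
  exact norm_integral_fourier_mul_cexp_le hf hg hε.1 hε.2 hR x

theorem integrable_min_one_div_pow_sq :
    Integrable fun y : E => (min 1 ‖y‖ / ‖y‖ ^ 3) ^ 2 := by
  rw [integrable_fun_norm_addHaar volume (f := fun r : ℝ => (min 1 r / r ^ 3) ^ 2),
    finrank_euclideanSpace_fin]
  refine Integrable.mono' (integrable_inv_one_add_sq.const_mul 2).integrableOn
    (by fun_prop) ?_
  refine (ae_restrict_mem measurableSet_Ioi).mono fun r (hr : 0 < r) => ?_
  rw [smul_eq_mul, Real.norm_of_nonneg (by positivity)]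
  have h1 : r ^ (5 - 1) * (min 1 r / r ^ 3) ^ 2 = (min 1 r / r) ^ 2 := by
    field_simp
  rw [h1, ← div_eq_mul_inv, le_div_iff₀ (by positivity), div_pow, div_mul_eq_mul_div,
    div_le_iff₀ (by positivity)]
  rcases le_total 1 r with h | h
  · rw [min_eq_left h]; nlinarith
  · rw [min_eq_right h]; nlinarith [mul_nonneg (sq_nonneg r) (by nlinarith : 0 ≤ 1 - r ^ 2)]

theorem integral_min_one_div_pow_sq {R : ℝ} (hR : 0 < R) :
    Integrable (fun y : E => (min 1 (‖y‖ / R) / ‖y‖ ^ 3) ^ 2) ∧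
      ∫ y : E, (min 1 (‖y‖ / R) / ‖y‖ ^ 3) ^ 2 =
        R⁻¹ * ∫ y : E, (min 1 ‖y‖ / ‖y‖ ^ 3) ^ 2 := by
  have h : (fun y : E => (min 1 (‖y‖ / R) / ‖y‖ ^ 3) ^ 2) =
      fun y => (R⁻¹) ^ 6 * (min 1 ‖R⁻¹ • y‖ / ‖R⁻¹ • y‖ ^ 3) ^ 2 := by
    ext y
    rw [norm_smul, norm_inv, Real.norm_of_nonneg hR.le, inv_mul_eq_div]
    field_simp
  rw [h]
  refine ⟨(integrable_min_one_div_pow_sq.comp_smul (inv_ne_zero hR.ne')).const_mul _, ?_⟩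
  rw [integral_const_mul, Measure.integral_comp_inv_smul_of_nonneg volume
    (fun y : E => (min 1 ‖y‖ / ‖y‖ ^ 3) ^ 2) hR.le, finrank_euclideanSpace_fin, smul_eq_mul,
    ← mul_assoc]
  congr 1
  field_simp

theorem norm_pow_three_le_rpow (y : E) : ‖y‖ ^ 3 ≤ (1 + ‖y‖ ^ 2) ^ ((3 : ℝ) / 2) := by
  calc ‖y‖ ^ 3 = (‖y‖ ^ 2) ^ ((3 : ℝ) / 2) := by
        rw [← Real.rpow_natCast ‖y‖ 2, ← Real.rpow_mul (norm_nonneg _), ← Real.rpow_natCast]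
        norm_num
    _ ≤ _ := by gcongr; linarith

/-- An `L²` function with weight `⟨y⟩³` is integrable in dimension `5`. -/
theorem integrable_of_memLp_weight {f : E → ℂ}
    (hF : MemLp (fun y : E => (((1 + ‖y‖ ^ 2) ^ ((3 : ℝ) / 2) : ℝ)) • f y) 2 volume) :
    Integrable f := by
  have hw : MemLp (fun y : E => (1 + ‖y‖ ^ 2) ^ (-(3 : ℝ) / 2)) 2 volume := by
    have hm : AEStronglyMeasurable (fun y : E => (1 + ‖y‖ ^ 2) ^ (-(3 : ℝ) / 2)) volume := by
      apply Measurable.aestronglyMeasurable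
      fun_prop
    rw [memLp_two_iff_integrable_sq hm]
    have := integrable_rpow_neg_one_add_norm_sq (μ := (volume : Measure E)) (r := 6)
      (by rw [finrank_euclideanSpace_fin]; norm_num)
    refine this.congr (ae_of_all _ fun y => ?_)
    simp only
    rw [← Real.rpow_natCast ((1 + ‖y‖ ^ 2) ^ (-(3 : ℝ) / 2)), ← Real.rpow_mul (by positivity)]
    norm_num
  have := memLp_one_iff_integrable.1 (hF.smul hw)
  refine this.congr (ae_of_all _ fun y => ?_)
  simp only [Pi.smul_apply']
  rw [smul_smul, ← Real.rpow_add (by positivity)]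
  norm_num

theorem integral_norm_mul_min_le {f : E → ℂ}
    (hF : MemLp (fun y : E => (((1 + ‖y‖ ^ 2) ^ ((3 : ℝ) / 2) : ℝ)) • f y) 2 volume)
    {R : ℝ} (hR : 0 < R) :
    ∫ y, ‖f y‖ * min 1 (‖y‖ / R) ≤
      √(∫ y : E, (min 1 ‖y‖ / ‖y‖ ^ 3) ^ 2) * (√R)⁻¹ *
        (eLpNorm (fun y : E => (((1 + ‖y‖ ^ 2) ^ ((3 : ℝ) / 2) : ℝ)) • f y) 2 volume).toReal := by
  set F : E → ℂ := fun y => (((1 + ‖y‖ ^ 2) ^ ((3 : ℝ) / 2) : ℝ)) • f y with hFdef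
  obtain ⟨hki, hkint⟩ := integral_min_one_div_pow_sq hR
  set k : E → ℝ := fun y => min 1 (‖y‖ / R) / ‖y‖ ^ 3 with hk
  have hk0 : ∀ y, 0 ≤ k y := fun y => by rw [hk]; positivity
  have hkm : MemLp k 2 volume := by
    rw [memLp_two_iff_integrable_sq]
    · exact hki
    · exact (by fun_prop : Measurable k).aestronglyMeasurable
  have hpt : ∀ y, ‖f y‖ * min 1 (‖y‖ / R) ≤ ‖F y‖ * k y := fun y => by
    rcases eq_or_ne y 0 with rfl | hy
    · simpa using mul_nonneg (norm_nonneg (F 0)) (hk0 0)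
    · have hy' : 0 < ‖y‖ := norm_pos_iff.2 hy
      have h1 : ‖y‖ ^ 3 * ‖f y‖ ≤ ‖F y‖ := by
        rw [hFdef, norm_smul, Real.norm_of_nonneg (by positivity)]
        gcongr
        exact norm_pow_three_le_rpow y
      calc ‖f y‖ * min 1 (‖y‖ / R) = ‖y‖ ^ 3 * ‖f y‖ * k y := by
            simp only [hk]; field_simp
        _ ≤ _ := by gcongr
  have hi : Integrable fun y => ‖F y‖ * k y := hF.norm.integrable_mul hkm
  have hCS := integral_mul_norm_le_Lp_mul_Lq (p := 2) (q := 2) (f := fun y => ‖F y‖) (g := k)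
    (μ := volume) Real.HolderConjugate.two_two (by simpa using hF.norm) (by simpa using hkm)
  have hFN : (∫ y, ‖‖F y‖‖ ^ (2 : ℝ)) ^ (1 / 2 : ℝ) = (eLpNorm F 2 volume).toReal := by
    rw [hF.eLpNorm_eq_integral_rpow_norm (by norm_num) (by norm_num),
      ENNReal.toReal_ofReal (by positivity)]
    simp
  have hkN : (∫ y, ‖k y‖ ^ (2 : ℝ)) ^ (1 / 2 : ℝ) =
      √(∫ y : E, (min 1 ‖y‖ / ‖y‖ ^ 3) ^ 2) * (√R)⁻¹ := by
    rw [← Real.sqrt_eq_rpow, mul_comm, ← Real.sqrt_inv, ← Real.sqrt_mul (by positivity), ← hkint]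
    simp only [Real.rpow_ofNat, Real.norm_eq_abs, sq_abs, hk]
  calc _ ≤ ∫ y, ‖F y‖ * k y :=
        integral_mono_of_nonneg (ae_of_all _ fun y => by positivity) hi (ae_of_all _ hpt)
    _ ≤ _ := by
      rw [hFN, hkN, mul_comm] at hCS
      refine le_trans (le_of_eq ?_) hCS
      congr 1 with y
      rw [norm_norm, Real.norm_of_nonneg (hk0 y)]

theorem enorm_le_eLpNorm_top_of_continuous {g : E → ℂ} (hg : Continuous g) (x : E) :
    ‖g x‖ₑ ≤ eLpNorm g ⊤ volume := by
  have hae : ∀ᵐ y, ‖g y‖ₑ ≤ eLpNorm g ⊤ volume := by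
    rw [eLpNorm_exponent_top]
    exact enorm_ae_le_eLpNormEssSup g volume
  have hcl : IsClosed {y | ‖g y‖ₑ ≤ eLpNorm g ⊤ volume} :=
    isClosed_le hg.enorm continuous_const
  have hd := (Measure.dense_of_ae hae).closure_eq
  rw [hcl.closure_eq] at hd
  exact hd.ge (Set.mem_univ x)

/-- Linear dispersive estimate for the bilaplacian on `ℝ⁵`: for `t > 0`,
`‖e^{itΔ²} f‖_{L^∞} ≲ t^{−5/4} ‖𝓕 f‖_{L^∞} + t^{−11/8} ‖𝓕 f‖_{H³}`, where the `H³`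
norm of `g = 𝓕 f` is realized on the Fourier side as `‖⟨ξ⟩³ 𝓕 g‖_{L²}`. -/
theorem linear_dispersive_estimate :
    ∃ C : ℝ, 0 < C ∧ ∀ (t : ℝ), 0 < t → ∀ f : E → ℂ,
      eLpNorm (𝓕⁻ fun ξ : E =>
          Complex.exp (Complex.I * (t : ℂ) * ((‖ξ‖ ^ 4 : ℝ) : ℂ)) * 𝓕 f ξ) ⊤ volume ≤
        ENNReal.ofReal (C * t ^ (-(5 : ℝ) / 4)) * eLpNorm (𝓕 f) ⊤ volume +
          ENNReal.ofReal (C * t ^ (-(11 : ℝ) / 8)) *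
            eLpNorm (fun ξ : E => (((1 + ‖ξ‖ ^ 2) ^ ((3 : ℝ) / 2) : ℝ)) • 𝓕 (𝓕 f) ξ)
              2 volume := by
  set D := √(∫ y : E, (min 1 ‖y‖ / ‖y‖ ^ 3) ^ 2) with hD
  set K := Real.exp 1 * 2 * (√(2 * Real.pi) ^ 5 * Real.pi) * Real.pi with hK
  have hK0 : 0 < K := by positivity
  have hD0 : 0 ≤ D := Real.sqrt_nonneg _
  refine ⟨K * (D + 1), by positivity, fun t ht f => ?_⟩
  by_cases hf : Integrable f
  swap
  · have h0 : 𝓕 f = 0 := by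
      ext ξ
      rw [Real.fourier_eq]
      exact integral_undef fun h => hf ((Real.fourierIntegral_convergent_iff ξ).1 h)
    have h1 : 𝓕⁻ (fun _ : E => (0 : ℂ)) = 0 := by
      ext x
      simp [Real.fourierInv_eq]
    simp [h0, h1]
  set g : E → ℂ := 𝓕 f with hg
  have hgc : Continuous g := continuous_fourier_of_integrable_s11 hf
  by_cases hgi : Integrable g
  swap
  · have h0 : 𝓕⁻ (fun ξ : E =>
        Complex.exp (Complex.I * (t : ℂ) * ((‖ξ‖ ^ 4 : ℝ) : ℂ)) * g ξ) = 0 := by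
      ext x
      rw [Real.fourierInv_eq']
      refine integral_undef fun h => hgi ?_
      refine (integrable_norm_iff hgc.aestronglyMeasurable).1 (h.norm.congr (ae_of_all _ fun ξ => ?_))
      simp [Complex.norm_exp, -Complex.ofReal_pow]
    rw [h0]
    simp
  set N := eLpNorm (fun ξ : E => (((1 + ‖ξ‖ ^ 2) ^ ((3 : ℝ) / 2) : ℝ)) • 𝓕 g ξ) 2 volume with hN
  by_cases hNtop : N = ⊤
  · rw [hNtop, ENNReal.mul_top (by positivity)]
    simp
  have hFg : Continuous (𝓕 g) := continuous_fourier_of_integrable_s11 hgi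
  set f₁ : E → ℂ := 𝓕⁻ g with hf₁
  have hf₁g : ∀ y, f₁ y = 𝓕 g (-y) := fun y => Real.fourierInv_eq_fourier_neg g y
  have hm : AEStronglyMeasurable
      (fun ξ : E => (((1 + ‖ξ‖ ^ 2) ^ ((3 : ℝ) / 2) : ℝ)) • 𝓕 g ξ) volume := by
    have : Measurable fun ξ : E => (1 + ‖ξ‖ ^ 2) ^ ((3 : ℝ) / 2) := by fun_prop
    exact (this.smul hFg.measurable).aestronglyMeasurable
  have hcomp : (fun y : E => (((1 + ‖y‖ ^ 2) ^ ((3 : ℝ) / 2) : ℝ)) • f₁ y) =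
      (fun ξ : E => (((1 + ‖ξ‖ ^ 2) ^ ((3 : ℝ) / 2) : ℝ)) • 𝓕 g ξ) ∘ Neg.neg := by
    ext y
    simp [hf₁g]
  have hneg : MeasurePreserving (Neg.neg : E → E) volume volume :=
    Measure.measurePreserving_neg volume
  have hN₁ : eLpNorm (fun y : E => (((1 + ‖y‖ ^ 2) ^ ((3 : ℝ) / 2) : ℝ)) • f₁ y) 2 volume = N := by
    rw [hcomp, eLpNorm_comp_measurePreserving hm hneg]
  have hF : MemLp (fun y : E => (((1 + ‖y‖ ^ 2) ^ ((3 : ℝ) / 2) : ℝ)) • f₁ y) 2 volume := by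
    rw [hcomp]
    exact MemLp.comp_measurePreserving ⟨hm, lt_top_iff_ne_top.2 hNtop⟩ hneg
  have hf₁i : Integrable f₁ := integrable_of_memLp_weight hF
  have hFgi : Integrable (𝓕 g) := by
    refine (hneg.integrable_comp hFg.aestronglyMeasurable).1 (hf₁i.congr (ae_of_all _ hf₁g))
  have hgf₁ : 𝓕 f₁ = g := hgc.fourier_fourierInv_eq hgi hFgi
  set R := t ^ (1 / 4 : ℝ) with hRdef
  have hR : 0 < R := by positivity
  have hR4 : R ^ 4 = t := by
    rw [hRdef, ← Real.rpow_natCast, ← Real.rpow_mul ht.le]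
    norm_num
  have hR5 : (R ^ 5)⁻¹ = t ^ (-(5 : ℝ) / 4) := by
    rw [hRdef, ← Real.rpow_natCast, ← Real.rpow_mul ht.le, ← Real.rpow_neg ht.le]
    norm_num
  have hRs : (R ^ 5)⁻¹ * (√R)⁻¹ = t ^ (-(11 : ℝ) / 8) := by
    rw [hR5, Real.sqrt_eq_rpow, hRdef, ← Real.rpow_mul ht.le, ← Real.rpow_neg ht.le,
      ← Real.rpow_add ht]
    norm_num
  have hmom := integral_norm_mul_min_le hF hR
  rw [hN₁, ← hD] at hmom
  rw [eLpNorm_exponent_top]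
  refine eLpNormEssSup_le_of_ae_enorm_bound (ae_of_all _ fun x => ?_)
  have hmain := norm_fourierInv_cexp_mul_fourier_le hf₁i (hgf₁ ▸ hgi) hR x
  rw [hgf₁, hR4] at hmain
  have hreal : Real.exp 1 * 2 * (√(2 * Real.pi) ^ 5 * Real.pi * (R ^ 5)⁻¹ *
        (‖g 0‖ + ∫ y, ‖f₁ y‖ * min 1 (‖y‖ / R))) * Real.pi ≤
      K * (D + 1) * t ^ (-(5 : ℝ) / 4) * ‖g 0‖ +
        K * (D + 1) * t ^ (-(11 : ℝ) / 8) * N.toReal := by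
    rw [← hRs, ← hR5]
    calc _ = K * (R ^ 5)⁻¹ * (‖g 0‖ + ∫ y, ‖f₁ y‖ * min 1 (‖y‖ / R)) := by rw [hK]; ring
      _ ≤ K * (R ^ 5)⁻¹ * (‖g 0‖ + D * (√R)⁻¹ * N.toReal) := by gcongr
      _ = K * 1 * (R ^ 5)⁻¹ * ‖g 0‖ + K * D * ((R ^ 5)⁻¹ * (√R)⁻¹) * N.toReal := by ring
      _ ≤ _ := by gcongr <;> linarith
  calc _ ≤ ENNReal.ofReal (K * (D + 1) * t ^ (-(5 : ℝ) / 4) * ‖g 0‖ +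
        K * (D + 1) * t ^ (-(11 : ℝ) / 8) * N.toReal) := by
        rw [← ofReal_norm]
        exact ENNReal.ofReal_le_ofReal (hmain.trans hreal)
    _ = ENNReal.ofReal (K * (D + 1) * t ^ (-(5 : ℝ) / 4)) * ‖g 0‖ₑ +
        ENNReal.ofReal (K * (D + 1) * t ^ (-(11 : ℝ) / 8)) * N := by
        rw [ENNReal.ofReal_add (by positivity) (by positivity),
          ENNReal.ofReal_mul (by positivity), ENNReal.ofReal_mul (q := N.toReal) (by positivity),
          ENNReal.ofReal_toReal hNtop, ofReal_norm]
    _ ≤ _ := by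
        gcongr
        exact enorm_le_eLpNorm_top_of_continuous hgc 0
end
end
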